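/- arXiv:1008.5338 — 2 statements merged into one kernel-verified Lean document; each statement's English description precedes it below -/
import Mathlib

section
/- Let (X,T) be a topological dynamical system, f ∈ C(X,ℝ), and μ an ergodic T-invariant Borel probability measure with h_μ(T) > 0. Then for μ-almost every x ∈ X, lim_{ε→0} P_s(T,f,x,ε) ≥ P_μ(T,f). -/
open Filter Set Topology MeasureTheory

noncomputable section

variable {X : Type*}

/-- Birkhoff sum `f_n(x) = ∑_{j<n} f(T^j x)`. -/
def birk (T : X → X) (f : X → ℝ) (n : ℕ) (x : X) : ℝ :=
  ∑ j ∈ Finset.range n, f (T^[j] x)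

/-- `P_n(T,f,δ,K)`: supremum of `∑_{x∈E} exp f_n(x)` over `(n,δ)`-separated
subsets `E ⊆ K`. -/
def sepPn [MetricSpace X] (T : X → X) (f : X → ℝ) (n : ℕ) (δ : ℝ) (K : Set X) : ℝ :=
  sSup { r : ℝ | ∃ E : Finset X, ↑E ⊆ K ∧
    (∀ x ∈ E, ∀ y ∈ E, x ≠ y → ∃ i < n, δ < dist (T^[i] x) (T^[i] y)) ∧
    r = ∑ x ∈ E, Real.exp (birk T f n x) }

/-- The topological pressure of `T` for the subset `K`:
`P(T,f,K) = lim_{δ→0} limsup_n (1/n) log P_n(T,f,δ,K)`; since the expression is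
nonincreasing in `δ`, the limit is the supremum over `δ > 0`. -/
def pres [MetricSpace X] (T : X → X) (f : X → ℝ) (K : Set X) : EReal :=
  ⨆ (δ : ℝ) (_ : 0 < δ), atTop.limsup fun n : ℕ =>
    ((Real.log (sepPn T f n δ K) / n : ℝ) : EReal)

/-- The `ε`-stable set `W^s_ε(x,T)`. -/
def epsStable [MetricSpace X] (T : X → X) (ε : ℝ) (x : X) : Set X :=
  { y | ∀ n : ℕ, dist (T^[n] x) (T^[n] y) ≤ ε }

/-- The topological pressure of the preimages of the `ε`-stable set of `x`:
`P_s(T,f,x,ε) = lim_{δ→0} limsup_n (1/n) log P_n(T,f,δ,T^{-n}W^s_ε(x,T))`. -/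
def Ps [MetricSpace X] (T : X → X) (f : X → ℝ) (x : X) (ε : ℝ) : EReal :=
  ⨆ (δ : ℝ) (_ : 0 < δ), atTop.limsup fun n : ℕ =>
    ((Real.log (sepPn T f n δ ((T^[n]) ⁻¹' epsStable T ε x)) / n : ℝ) : EReal)

/-- A finite open cover of `X`. -/
def IsOpenCover [TopologicalSpace X] (𝒰 : Finset (Set X)) : Prop :=
  (∀ U ∈ 𝒰, IsOpen U) ∧ ⋃₀ (𝒰 : Set (Set X)) = univ

/-- A finite Borel cover of `X`. -/
def IsBorelCover [MeasurableSpace X] (𝒱 : Finset (Set X)) : Prop :=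
  (∀ V ∈ 𝒱, MeasurableSet V) ∧ ⋃₀ (𝒱 : Set (Set X)) = univ

/-- `𝒱` refines the iterated cover `𝒰_0^{n-1} = ⋁_{i<n} T^{-i}𝒰`. -/
def RefinesIter (T : X → X) (𝒰 : Finset (Set X)) (n : ℕ) (𝒱 : Finset (Set X)) : Prop :=
  ∀ V ∈ 𝒱, ∃ g : Fin n → Set X, (∀ i, g i ∈ 𝒰) ∧ V ⊆ ⋂ i : Fin n, (T^[(i : ℕ)]) ⁻¹' g i

/-- `P_n(T,f,𝒰,K)`: infimum over finite Borel covers `𝒱` refining `𝒰_0^{n-1}` of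
`∑_{V∈𝒱} sup_{x ∈ V∩K} exp f_n(x)` (an empty summand contributes `0`, which is
`Real.sSup ∅`). -/
def covPn [MeasurableSpace X] (T : X → X) (f : X → ℝ) (𝒰 : Finset (Set X)) (n : ℕ)
    (K : Set X) : ℝ :=
  sInf { r : ℝ | ∃ 𝒱 : Finset (Set X), IsBorelCover 𝒱 ∧ RefinesIter T 𝒰 n 𝒱 ∧
    r = ∑ V ∈ 𝒱, sSup ((fun x => Real.exp (birk T f n x)) '' (V ∩ K)) }

/-- A finite Borel partition of `X`. -/
def IsFinPartition [MeasurableSpace X] (α : Finset (Set X)) : Prop :=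
  (∀ A ∈ α, MeasurableSet A) ∧ ⋃₀ (α : Set (Set X)) = univ ∧
    (α : Set (Set X)).Pairwise Disjoint

/-- `H_μ(⋁_{i<n} T^{-i}α)`, computed over all atoms `⋂_{i<n} T^{-i} A_i`. -/
def dynH [MeasurableSpace X] (μ : Measure X) (T : X → X) (α : Finset (Set X)) (n : ℕ) : ℝ :=
  ∑ g : Fin n → α, Real.negMulLog ((μ (⋂ i : Fin n, (T^[(i : ℕ)]) ⁻¹' (g i : Set X))).toReal)

/-- `h_μ(T,α) = lim_n (1/n) H_μ(α_0^{n-1})`, which for an invariant measure equals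
the infimum of `(1/n) H_μ(α_0^{n-1})` over `n ≥ 1`. -/
def entPart [MeasurableSpace X] (μ : Measure X) (T : X → X) (α : Finset (Set X)) : ℝ :=
  ⨅ n : ℕ, dynH μ T α (n + 1) / (n + 1 : ℝ)

/-- The measure-theoretic entropy `h_μ(T)`. -/
def mEnt [MeasurableSpace X] (μ : Measure X) (T : X → X) : EReal :=
  ⨆ (α : Finset (Set X)) (_ : IsFinPartition α), ((entPart μ T α : ℝ) : EReal)

/-- The measure-theoretic pressure `P_μ(T,f) = h_μ(T) + ∫ f dμ`. -/
def mPres [MeasurableSpace X] (μ : Measure X) (T : X → X) (f : X → ℝ) : EReal :=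
  mEnt μ T + ((∫ x, f x ∂μ : ℝ) : EReal)

/-- The stable set `W^s(x,T)`. -/
def stableSet [MetricSpace X] (T : X → X) (x : X) : Set X :=
  { y | Tendsto (fun n : ℕ => dist (T^[n] x) (T^[n] y)) atTop (𝓝 0) }

/-- A Cantor set: a nonempty compact perfect totally disconnected set. -/
def IsCantorSet [TopologicalSpace X] (C : Set X) : Prop :=
  C.Nonempty ∧ IsCompact C ∧ Perfect C ∧ IsTotallyDisconnected C

/-- A weakly mixing set for `T`. -/
def IsWeaklyMixingSet [TopologicalSpace X] (T : X → X) (A : Set X) : Prop :=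
  A.Nonempty ∧ IsClosed A ∧
  ∃ B : Set X, B ⊆ A ∧
    (∃ C : ℕ → Set X, (∀ n, IsCantorSet (C n)) ∧ B = ⋃ n, C n) ∧
    closure B = A ∧
    ∀ C : Set X, C ⊆ B → IsCantorSet C →
      ∀ g : C → X, Continuous g → (∀ c : C, g c ∈ A) →
        ∃ φ : ℕ → ℕ, StrictMono φ ∧
          ∀ c : C, Tendsto (fun i => T^[φ i] (c : X)) atTop (𝓝 (g c))

section Entropy

variable {κ l : Type*}

/-- The entropy of the finite partition of `X` into the level sets of `φ`. -/
def labelEntropy [Fintype κ] [MeasurableSpace X] (μ : Measure X) (φ : X → κ) : ℝ :=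
  ∑ k, Real.negMulLog (μ.real (φ ⁻¹' {k}))

theorem negMulLog_sum_le {s : Finset κ} {p : κ → ℝ} (hp : ∀ k ∈ s, 0 ≤ p k) :
    Real.negMulLog (∑ k ∈ s, p k) ≤ ∑ k ∈ s, Real.negMulLog (p k) := by
  rw [Real.negMulLog, neg_mul, Finset.sum_mul, ← Finset.sum_neg_distrib]
  refine Finset.sum_le_sum fun k hk => ?_
  rcases (hp k hk).eq_or_lt with h | h
  · simp [← h]
  · rw [Real.negMulLog, neg_mul]
    have := Real.log_le_log h (Finset.single_le_sum hp hk)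
    gcongr

theorem sum_fiber_measureReal [Fintype κ] [MeasurableSpace X] [DecidableEq l] (μ : Measure X)
    [IsFiniteMeasure μ] {φ : X → κ} (hφ : ∀ k, MeasurableSet (φ ⁻¹' {k})) (π : κ → l) (j : l) :
    ∑ k with π k = j, μ.real (φ ⁻¹' {k}) = μ.real ((π ∘ φ) ⁻¹' {j}) := by
  rw [sum_measureReal_preimage_singleton _ fun k _ => hφ k]
  congr 1
  ext x
  simp

theorem labelEntropy_comp_le [Fintype κ] [Fintype l] [MeasurableSpace X] (μ : Measure X) [IsFiniteMeasure μ]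
    {φ : X → κ} (hφ : ∀ k, MeasurableSet (φ ⁻¹' {k})) (π : κ → l) :
    labelEntropy μ (π ∘ φ) ≤ labelEntropy μ φ := by
  classical
  rw [labelEntropy, labelEntropy, ← Finset.sum_fiberwise Finset.univ π]
  refine Finset.sum_le_sum fun j _ => ?_
  rw [← sum_fiber_measureReal μ hφ]
  exact negMulLog_sum_le fun k _ => measureReal_nonneg

theorem labelEntropy_nonneg [Fintype κ] [MeasurableSpace X] (μ : Measure X) [IsProbabilityMeasure μ]
    (φ : X → κ) : 0 ≤ labelEntropy μ φ :=
  Finset.sum_nonneg fun _ _ => Real.negMulLog_nonneg measureReal_nonneg measureReal_le_one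

theorem integral_eq_sum_setIntegral_preimage [Fintype κ] [MeasurableSpace X] {μ : Measure X}
    {φ : X → κ} (hφ : ∀ k, MeasurableSet (φ ⁻¹' {k})) {g : X → ℝ} (hg : Integrable g μ) :
    ∫ x, g x ∂μ = ∑ k, ∫ x in φ ⁻¹' {k}, g x ∂μ := by
  rw [← integral_iUnion_fintype hφ (fun a b hab => ?_) fun _ => hg.integrableOn]
  · rw [← Set.preimage_iUnion, Set.iUnion_of_singleton, Set.preimage_univ, setIntegral_univ]
  · exact Disjoint.preimage _ (by simpa using hab)

/-- The finite Gibbs inequality. -/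
theorem sum_negMulLog_add_mul_le {s : Finset κ} {p g : κ → ℝ} (hp : ∀ k ∈ s, 0 < p k) :
    ∑ k ∈ s, (Real.negMulLog (p k) + p k * g k) ≤
      Real.negMulLog (∑ k ∈ s, p k) + (∑ k ∈ s, p k) * Real.log (∑ k ∈ s, Real.exp (g k)) := by
  rcases s.eq_empty_or_nonempty with rfl | hs
  · simp
  set q := ∑ k ∈ s, p k with hq
  set S := ∑ k ∈ s, Real.exp (g k) with hS
  have hq0 : 0 < q := Finset.sum_pos hp hs
  have hS0 : 0 < S := Finset.sum_pos (fun k _ => Real.exp_pos _) hs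
  have key : ∀ k ∈ s, Real.negMulLog (p k) + p k * g k ≤
      p k * (Real.log S - Real.log q) + (Real.exp (g k) * q / S - p k) := fun k hk => by
    have h0 := hp k hk
    have h1 := Real.log_le_sub_one_of_pos (x := Real.exp (g k) * q / (p k * S)) (by positivity)
    rw [Real.log_div (by positivity) (by positivity), Real.log_mul (by positivity) (by positivity),
      Real.log_mul (by positivity) (by positivity), Real.log_exp] at h1
    have h2 := mul_le_mul_of_nonneg_left h1 h0.le
    have h3 : p k * (Real.exp (g k) * q / (p k * S) - 1) = Real.exp (g k) * q / S - p k := by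
      field_simp
    rw [h3] at h2
    rw [Real.negMulLog]
    linarith
  refine (Finset.sum_le_sum key).trans_eq ?_
  rw [Finset.sum_add_distrib, Finset.sum_sub_distrib, ← Finset.sum_mul, ← Finset.sum_div,
    ← Finset.sum_mul, ← hq, ← hS, Real.negMulLog]
  field_simp
  ring

/-- A variational inequality relative to a coarser partition: in each cell of positive measure
one can choose a point so that the exponential sums over the cells of the fine partition inside
the cells of the coarse one dominate the conditional entropy plus the integral. -/
theorem exists_points_labelEntropy_add_integral_le [Fintype κ] [Fintype l] [MeasurableSpace X] [DecidableEq l]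
    (μ : Measure X) [IsProbabilityMeasure μ]
    {φ : X → κ} (hφ : ∀ k, MeasurableSet (φ ⁻¹' {k})) (π : κ → l)
    {g : X → ℝ} (hg : Integrable g μ) :
    ∃ (y : κ → X) (P : Finset κ), (∀ k ∈ P, φ (y k) = k) ∧
      (∀ j, 0 < μ.real ((π ∘ φ) ⁻¹' {j}) → ({k ∈ P | π k = j}).Nonempty) ∧
      labelEntropy μ φ + ∫ x, g x ∂μ ≤ labelEntropy μ (π ∘ φ) +
        ∑ j, μ.real ((π ∘ φ) ⁻¹' {j}) * Real.log (∑ k ∈ P with π k = j, Real.exp (g (y k))) := by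
  classical
  have hX : Nonempty X := nonempty_of_isProbabilityMeasure μ
  have hex : ∀ k, ∃ x, 0 < μ.real (φ ⁻¹' {k}) →
      φ x = k ∧ ∫ z in φ ⁻¹' {k}, g z ∂μ ≤ μ.real (φ ⁻¹' {k}) * g x := fun k => by
    by_cases h : 0 < μ.real (φ ⁻¹' {k})
    · obtain ⟨x, hx, hgx⟩ := exists_setAverage_le (μ := μ) (s := φ ⁻¹' {k}) (f := g)
        (fun h' => by simp [measureReal_def, h'] at h) (measure_ne_top _ _) hg.integrableOn
      refine ⟨x, fun _ => ⟨hx, ?_⟩⟩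
      rw [setAverage_eq, smul_eq_mul, inv_mul_le_iff₀ h] at hgx
      exact hgx
    · exact ⟨hX.some, fun h' => absurd h' h⟩
  choose y hy using hex
  have hzero : ∀ k, ¬ 0 < μ.real (φ ⁻¹' {k}) → μ.real (φ ⁻¹' {k}) = 0 := fun k h =>
    le_antisymm (not_lt.1 h) measureReal_nonneg
  set P : Finset κ := {k | 0 < μ.real (φ ⁻¹' {k})} with hP
  have hsum : ∀ j, ∑ k ∈ P with π k = j, μ.real (φ ⁻¹' {k}) = μ.real ((π ∘ φ) ⁻¹' {j}) := by
    intro j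
    rw [← sum_fiber_measureReal μ hφ]
    refine Finset.sum_subset (Finset.filter_subset_filter _ (Finset.subset_univ _)) ?_
    intro k hk hk'
    refine hzero k fun h => hk' ?_
    simp only [Finset.mem_filter, Finset.mem_univ, true_and, hP] at hk ⊢
    exact ⟨h, hk⟩
  have hpos : ∀ k ∈ P, 0 < μ.real (φ ⁻¹' {k}) := fun k hk => by simpa [hP] using hk
  refine ⟨y, P, fun k hk => (hy k (hpos k hk)).1, fun j hj => ?_, ?_⟩
  · rw [← hsum] at hj
    exact Finset.nonempty_of_sum_ne_zero hj.ne'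
  · rw [labelEntropy, labelEntropy, integral_eq_sum_setIntegral_preimage hφ hg,
      ← Finset.sum_add_distrib, ← Finset.sum_add_distrib]
    have h1 : ∑ k, (Real.negMulLog (μ.real (φ ⁻¹' {k})) + ∫ x in φ ⁻¹' {k}, g x ∂μ) =
        ∑ k ∈ P, (Real.negMulLog (μ.real (φ ⁻¹' {k})) + ∫ x in φ ⁻¹' {k}, g x ∂μ) := by
      refine (Finset.sum_subset (Finset.subset_univ P) fun k _ hk => ?_).symm
      have h0 : μ.real (φ ⁻¹' {k}) = 0 := hzero k fun h => hk (by simpa [hP] using h)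
      rw [h0, setIntegral_measure_zero _ ((measureReal_eq_zero_iff).1 h0)]
      simp
    rw [h1, ← Finset.sum_fiberwise P π]
    refine Finset.sum_le_sum fun j _ => ?_
    rw [← hsum j]
    refine le_trans (Finset.sum_le_sum fun k hk => ?_)
      (sum_negMulLog_add_mul_le (g := fun k => g (y k))
        fun k hk => hpos k (Finset.mem_filter.1 hk).1)
    have := (hy k (hpos k (Finset.mem_filter.1 hk).1)).2
    linarith

/-- A reverse Markov inequality for finite weighted sums. -/
theorem le_sum_filter_mul_of_le_sum_mul [Fintype κ] {q s : κ → ℝ} {A B t : ℝ} (hq : ∀ k, 0 ≤ q k)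
    (hq1 : ∑ k, q k = 1) (hs : ∀ k, 0 < q k → s k ≤ B)
    (h : A ≤ ∑ k, q k * s k) :
    t ≤ (∑ k with 0 < q k ∧ A - t ≤ s k, q k) * (B - (A - t)) := by
  have key : ∀ k, q k * s k ≤ q k * (A - t) +
      if 0 < q k ∧ A - t ≤ s k then q k * (B - (A - t)) else 0 := fun k => by
    rcases (hq k).eq_or_lt with h0 | h0
    · simp [← h0]
    split_ifs with hk
    · have := mul_le_mul_of_nonneg_left (hs k h0) h0.le
      linarith
    · have : s k ≤ A - t := by
        by_contra h'
        exact hk ⟨h0, (not_le.1 h').le⟩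
      have := mul_le_mul_of_nonneg_left this h0.le
      linarith
  have := h.trans (Finset.sum_le_sum fun k _ => key k)
  rw [Finset.sum_add_distrib, ← Finset.sum_mul, hq1, ← Finset.sum_filter, ← Finset.sum_mul] at this
  linarith

end Entropy

section Words

variable {ι : Type*}

/-- The itinerary of length `n` of `x` with respect to the labelling `c`. -/
def itinerary (T : X → X) (c : X → ι) (n : ℕ) (x : X) : Fin n → ι := fun i => c (T^[i] x)

theorem itinerary_preimage (T : X → X) (c : X → ι) (n : ℕ) (w : Fin n → ι) :
    itinerary T c n ⁻¹' {w} = ⋂ i : Fin n, (T^[(i : ℕ)]) ⁻¹' (c ⁻¹' {w i}) := by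
  ext x
  simp [itinerary, funext_iff]

theorem itinerary_add (T : X → X) (c : X → ι) (n m : ℕ) (x : X) :
    itinerary T c (n + m) x = Fin.append (itinerary T c n x) (itinerary T c m (T^[n] x)) := by
  funext i
  refine Fin.addCases (fun i => ?_) (fun i => ?_) i
  · simp [itinerary]
  · simp [itinerary, ← Function.iterate_add_apply, add_comm]

variable [MeasurableSpace X]

theorem measurableSet_itinerary_preimage {T : X → X} (hT : Measurable T) {c : X → ι}
    (hc : ∀ a, MeasurableSet (c ⁻¹' {a})) (n : ℕ) (w : Fin n → ι) :
    MeasurableSet (itinerary T c n ⁻¹' {w}) := by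
  rw [itinerary_preimage]
  exact MeasurableSet.iInter fun i => hT.iterate i (hc _)

theorem measurableSet_itinerary_pair_preimage {T : X → X} (hT : Measurable T) {c : X → ι}
    (hc : ∀ a, MeasurableSet (c ⁻¹' {a})) (n m : ℕ) (w : (Fin n → ι) × (Fin m → ι)) :
    MeasurableSet ((fun x => (itinerary T c n x, itinerary T c m (T^[n] x))) ⁻¹' {w}) := by
  have : (fun x => (itinerary T c n x, itinerary T c m (T^[n] x))) ⁻¹' {w} =
      itinerary T c n ⁻¹' {w.1} ∩ T^[n] ⁻¹' (itinerary T c m ⁻¹' {w.2}) := by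
    ext x
    simp [Prod.ext_iff]
  rw [this]
  exact (measurableSet_itinerary_preimage hT hc n _).inter
    (hT.iterate n (measurableSet_itinerary_preimage hT hc m _))

variable [Fintype ι] {μ : Measure X}

theorem labelEntropy_itinerary_iterate {T : X → X} (hT : MeasurePreserving T μ μ) {c : X → ι}
    (hc : ∀ a, MeasurableSet (c ⁻¹' {a})) (n m : ℕ) :
    labelEntropy μ (fun x => itinerary T c m (T^[n] x)) = labelEntropy μ (itinerary T c m) := by
  refine Finset.sum_congr rfl fun w _ => ?_
  rw [← (hT.iterate n).measureReal_preimage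
    (measurableSet_itinerary_preimage hT.measurable hc m w).nullMeasurableSet]
  rfl

theorem labelEntropy_itinerary_add_le [IsProbabilityMeasure μ] {T : X → X} (hT : Measurable T)
    {c : X → ι} (hc : ∀ a, MeasurableSet (c ⁻¹' {a})) (n m : ℕ) :
    labelEntropy μ (itinerary T c (n + m)) ≤
      labelEntropy μ (fun x => (itinerary T c n x, itinerary T c m (T^[n] x))) := by
  have : itinerary T c (n + m) = (fun w : (Fin n → ι) × (Fin m → ι) => Fin.append w.1 w.2) ∘
      fun x => (itinerary T c n x, itinerary T c m (T^[n] x)) := by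
    funext x
    simp [itinerary_add]
  rw [this]
  exact labelEntropy_comp_le μ (measurableSet_itinerary_pair_preimage hT hc n m) _

/-- If `a N ≥ N h` for `N ≥ 1` then the increments of step `n` are almost `n h` infinitely
often. -/
theorem frequently_le_sub_of_mul_le {a : ℕ → ℝ} {h η : ℝ} (hη : 0 < η)
    (ha : ∀ N : ℕ, (N + 1) * h ≤ a (N + 1)) {n : ℕ} (hn : 0 < n) :
    ∃ᶠ m in atTop, n * (h - η) ≤ a (n + m) - a m := by
  intro hev
  simp only [not_le] at hev
  obtain ⟨M, hM⟩ := eventually_atTop.1 hev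
  have hind : ∀ j : ℕ, a (M + j * n) ≤ a M + j * n * (h - η) := by
    intro j
    induction j with
    | zero => simp
    | succ j ih =>
      have := hM (M + j * n) (by omega)
      rw [show M + (j + 1) * n = n + (M + j * n) by ring]
      push_cast
      linarith
  have hn' : (1 : ℝ) ≤ n := by exact_mod_cast hn
  obtain ⟨j, hj⟩ := exists_nat_gt ((a M - M * h) / η)
  rw [div_lt_iff₀ hη] at hj
  have h1 := hind (j + 1)
  have h2 := ha (M + (j + 1) * n - 1)
  have h3 : 0 < M + (j + 1) * n := by positivity
  have h4 : ((M + (j + 1) * n - 1 : ℕ) : ℝ) + 1 = M + (j + 1) * n := by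
    rw [← Nat.cast_add_one, Nat.sub_add_cancel h3]
    push_cast
    ring
  rw [h4, Nat.sub_add_cancel h3] at h2
  push_cast at h1
  have h5 : (j : ℝ) * η ≤ (j + 1) * n * η := by
    have : (j : ℝ) ≤ (j + 1) * n := by nlinarith
    gcongr
  linarith

end Words

section Partitions

variable [MeasurableSpace X]

/-- A finite Borel partition is the partition into level sets of a labelling by its elements. -/
theorem IsFinPartition.exists_label {α : Finset (Set X)} (hα : IsFinPartition α) :
    ∃ c : X → α, ∀ A : α, c ⁻¹' {A} = A := by
  have hex : ∀ x, ∃ A : α, x ∈ (A : Set X) := fun x => by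
    have : x ∈ ⋃₀ (α : Set (Set X)) := hα.2.1 ▸ mem_univ x
    obtain ⟨A, hA, hx⟩ := this
    exact ⟨⟨A, hA⟩, hx⟩
  choose c hc using hex
  refine ⟨c, fun A => ?_⟩
  ext x
  refine ⟨fun h => ?_, fun h => ?_⟩
  · rw [← (h : c x = A)]
    exact hc x
  · by_contra hne
    exact Set.disjoint_left.1 (hα.2.2 (c x).2 A.2 fun h' => hne (Subtype.ext h')) (hc x) h

theorem dynH_eq_labelEntropy {μ : Measure X} {T : X → X} {α : Finset (Set X)} {c : X → α}
    (hc : ∀ A : α, c ⁻¹' {A} = A) (n : ℕ) :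
    dynH μ T α n = labelEntropy μ (itinerary T c n) := by
  refine Finset.sum_congr rfl fun w _ => ?_
  rw [itinerary_preimage, measureReal_def]
  simp only [hc]

theorem entPart_mul_le {μ : Measure X} [IsProbabilityMeasure μ] {T : X → X} {α : Finset (Set X)}
    (hα : IsFinPartition α) (n : ℕ) : (n + 1) * entPart μ T α ≤ dynH μ T α (n + 1) := by
  obtain ⟨c, hc⟩ := hα.exists_label
  have hbdd : BddBelow (range fun n : ℕ => dynH μ T α (n + 1) / (n + 1 : ℝ)) := by
    refine ⟨0, ?_⟩
    rintro _ ⟨n, rfl⟩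
    have := labelEntropy_nonneg μ (itinerary T c (n + 1))
    rw [← dynH_eq_labelEntropy hc] at this
    positivity
  have := ciInf_le hbdd n
  rw [le_div_iff₀ (by positivity)] at this
  rw [mul_comm]
  exact this

end Partitions

/-- A compact metric space has finite measurable labellings with small level sets. -/
theorem exists_small_labelling [MetricSpace X] [CompactSpace X] [MeasurableSpace X] [BorelSpace X]
    {ε : ℝ} (hε : 0 < ε) : ∃ (t : Finset X) (b : X → t → Prop),
      (∀ a, MeasurableSet (b ⁻¹' {a})) ∧ ∀ x y, b x = b y → dist x y ≤ ε := by
  obtain ⟨t, -, ht, hcov⟩ := finite_cover_balls_of_compact (isCompact_univ (X := X)) (half_pos hε)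
  lift t to Finset X using ht
  refine ⟨t, fun x p => x ∈ Metric.ball (p : X) (ε / 2), fun a => ?_, fun x y h => ?_⟩
  · have : (fun (x : X) (p : t) => x ∈ Metric.ball (p : X) (ε / 2)) ⁻¹' {a} =
        ⋂ p : t, {x | x ∈ Metric.ball (p : X) (ε / 2) ↔ a p} := by
      ext x
      simp [funext_iff]
    rw [this]
    refine MeasurableSet.iInter fun p => ?_
    by_cases ha : a p
    · convert (Metric.isOpen_ball (x := (p : X)) (ε := ε / 2)).measurableSet using 1
      ext x
      simp [ha]
    · simpa [ha, Set.compl_def] using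
        (Metric.isOpen_ball (x := (p : X)) (ε := ε / 2)).measurableSet.compl
  · obtain ⟨p, hp, hx⟩ := mem_iUnion₂.1 (hcov (mem_univ x))
    have hy : y ∈ Metric.ball p (ε / 2) := (congrFun h ⟨p, hp⟩).mp hx
    rw [Metric.mem_ball] at hx hy
    linarith [dist_triangle_right x y p]

universe u

/-- Every finite Borel partition can be refined to a labelling with small level sets without
decreasing the entropies. -/
theorem exists_refined_labelling {X : Type u} [MetricSpace X] [CompactSpace X] [MeasurableSpace X]
    [BorelSpace X] {μ : Measure X} [IsProbabilityMeasure μ] {T : X → X} (hT : Measurable T)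
    {α : Finset (Set X)} (hα : IsFinPartition α) {ε : ℝ} (hε : 0 < ε) :
    ∃ (ι : Type u) (_ : Fintype ι) (c : X → ι), (∀ a, MeasurableSet (c ⁻¹' {a})) ∧
      (∀ x y, c x = c y → dist x y ≤ ε) ∧
      ∀ n : ℕ, (n + 1) * entPart μ T α ≤ labelEntropy μ (itinerary T c (n + 1)) := by
  classical
  obtain ⟨a, ha⟩ := hα.exists_label
  obtain ⟨t, b, hb, hbε⟩ := exists_small_labelling (X := X) hε
  have hc : ∀ p, MeasurableSet ((fun x => (a x, b x)) ⁻¹' {p}) := fun p => by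
    have : (fun x => (a x, b x)) ⁻¹' {p} = a ⁻¹' {p.1} ∩ b ⁻¹' {p.2} := by
      ext x
      simp [Prod.ext_iff]
    rw [this, ha]
    exact (hα.1 _ p.1.2).inter (hb _)
  refine ⟨α × (t → Prop), inferInstance, fun x => (a x, b x), hc, fun x y h => hbε x y (congrArg Prod.snd h), fun n => ?_⟩
  refine (entPart_mul_le hα n).trans ?_
  rw [dynH_eq_labelEntropy ha]
  exact labelEntropy_comp_le μ (measurableSet_itinerary_preimage hT hc (n + 1))
    (fun w i => (w i).1)

section Measure

variable [MeasurableSpace X] {μ : Measure X}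

theorem integrable_birk {T : X → X} (hT : MeasurePreserving T μ μ) {g : X → ℝ}
    (hg : Integrable g μ) (n : ℕ) : Integrable (birk T g n) μ :=
  integrable_finsetSum _ fun j _ => (hT.iterate j).integrable_comp_of_integrable hg

theorem integral_birk {T : X → X} (hT : MeasurePreserving T μ μ) {g : X → ℝ}
    (hg : Integrable g μ) (n : ℕ) : ∫ x, birk T g n x ∂μ = n * ∫ x, g x ∂μ := by
  have hj : ∀ j : ℕ, ∫ x, g (T^[j] x) ∂μ = ∫ x, g x ∂μ := fun j => by
    have h := (hT.iterate j).map_eq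
    have hg' : AEStronglyMeasurable g (μ.map T^[j]) := h.symm ▸ hg.aestronglyMeasurable
    rw [← integral_map (hT.iterate j).measurable.aemeasurable hg', h]
  simp only [birk]
  have hint : ∀ j : ℕ, Integrable (fun x => g (T^[j] x)) μ := fun j =>
    (hT.iterate j).integrable_comp_of_integrable hg
  rw [integral_finsetSum _ fun j _ => hint j]
  simp [hj]

theorem le_measure_setOf_frequently [IsFiniteMeasure μ] {s : ℕ → Set X}
    (hs : ∀ m, MeasurableSet (s m)) {p : ENNReal} (h : ∃ᶠ m in atTop, p ≤ μ (s m)) :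
    MeasurableSet {x | ∃ᶠ m in atTop, x ∈ s m} ∧ p ≤ μ {x | ∃ᶠ m in atTop, x ∈ s m} := by
  have heq : {x | ∃ᶠ m in atTop, x ∈ s m} = ⋂ N : ℕ, ⋃ m : ℕ, ⋃ _ : N ≤ m, s m := by
    ext x
    simp [frequently_atTop]
  have hmeas : ∀ N : ℕ, MeasurableSet (⋃ m : ℕ, ⋃ _ : N ≤ m, s m) := fun N =>
    MeasurableSet.iUnion fun m => MeasurableSet.iUnion fun _ => hs m
  rw [heq]
  refine ⟨MeasurableSet.iInter hmeas, ?_⟩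
  have hanti : Antitone fun N : ℕ => ⋃ m : ℕ, ⋃ _ : N ≤ m, s m := fun N N' hN =>
    iUnion_mono fun m => iUnion_mono' fun hm => ⟨hN.trans hm, subset_rfl⟩
  refine ge_of_tendsto' (tendsto_measure_iInter_atTop (fun N => (hmeas N).nullMeasurableSet) hanti
    ⟨0, measure_ne_top _ _⟩) fun N => ?_
  obtain ⟨m, hm, hp⟩ := frequently_atTop.1 h N
  exact hp.trans (measure_mono (subset_iUnion₂_of_subset m hm subset_rfl))

theorem exists_itineraries_sum_exp_ge [IsProbabilityMeasure μ] {ι : Type*} [Fintype ι] {T : X → X}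
    (hT : MeasurePreserving T μ μ) {c : X → ι} (hc : ∀ a, MeasurableSet (c ⁻¹' {a})) {g : X → ℝ}
    (hg : Integrable g μ) {M : ℝ} (hM : ∀ x, g x ≤ M) (n m : ℕ) {A t : ℝ}
    (hA : A ≤ labelEntropy μ (itinerary T c (n + m)) - labelEntropy μ (itinerary T c m) +
      n * ∫ x, g x ∂μ) :
    ∃ V : Finset (Fin m → ι),
      t ≤ μ.real (itinerary T c m ⁻¹' V) * (n * (Real.log (Fintype.card ι) + M) - (A - t)) ∧
      ∀ v ∈ V, ∃ (W : Finset (Fin n → ι)) (y : (Fin n → ι) → X),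
        (∀ w ∈ W, itinerary T c m (T^[n] (y w)) = v) ∧ (∀ w ∈ W, itinerary T c n (y w) = w) ∧
        Real.exp (A - t) ≤ ∑ w ∈ W, Real.exp (birk T g n (y w)) := by
  classical
  have hX : Nonempty X := nonempty_of_isProbabilityMeasure μ
  have hι : Nonempty ι := hX.map c
  have hψ := measurableSet_itinerary_preimage hT.measurable hc m
  obtain ⟨y, P, hy, hPne, hle⟩ := exists_points_labelEntropy_add_integral_le μ
    (measurableSet_itinerary_pair_preimage hT.measurable hc n m) Prod.snd (integrable_birk hT hg n)
  have hcomp : (Prod.snd ∘ fun x => (itinerary T c n x, itinerary T c m (T^[n] x))) =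
      fun x => itinerary T c m (T^[n] x) := rfl
  have hq : ∀ v, μ.real ((fun x => itinerary T c m (T^[n] x)) ⁻¹' {v}) =
      μ.real (itinerary T c m ⁻¹' {v}) := fun v => by
    rw [← (hT.iterate n).measureReal_preimage (hψ v).nullMeasurableSet]
    rfl
  rw [hcomp, labelEntropy_itinerary_iterate hT hc, integral_birk hT hg] at hle
  simp only [hcomp, hq] at hle hPne
  have hy1 : ∀ k ∈ P, itinerary T c n (y k) = k.1 := fun k hk => congrArg Prod.fst (hy k hk)
  have hy2 : ∀ k ∈ P, itinerary T c m (T^[n] (y k)) = k.2 := fun k hk =>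
    congrArg Prod.snd (hy k hk)
  have hinj : ∀ v : Fin m → ι, InjOn Prod.fst
      (({k ∈ P | k.2 = v} : Finset ((Fin n → ι) × (Fin m → ι))) :
        Set ((Fin n → ι) × (Fin m → ι))) := by
    intro v j hj k hk hjk
    simp only [Finset.coe_filter, mem_ofPred_eq] at hj hk
    exact Prod.ext hjk (hj.2.trans hk.2.symm)
  have hpos : ∀ v, 0 < μ.real (itinerary T c m ⁻¹' {v}) →
      0 < ∑ k ∈ P with k.2 = v, Real.exp (birk T g n (y k)) := fun v hv =>
    Finset.sum_pos (fun k _ => Real.exp_pos _) (hPne v hv)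
  have hB : ∀ v, 0 < μ.real (itinerary T c m ⁻¹' {v}) →
      Real.log (∑ k ∈ P with k.2 = v, Real.exp (birk T g n (y k))) ≤
        n * (Real.log (Fintype.card ι) + M) := fun v hv => by
    have hcard : (({k ∈ P | k.2 = v} : Finset ((Fin n → ι) × (Fin m → ι))).card : ℝ) ≤
        (Fintype.card ι : ℝ) ^ n := by
      have := Finset.card_le_card_of_injOn Prod.fst (t := Finset.univ)
        (fun _ _ => Finset.mem_univ _) (hinj v)
      rw [Finset.card_univ, Fintype.card_fun, Fintype.card_fin] at this
      exact_mod_cast this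
    have hbirk : ∀ x, birk T g n x ≤ n * M := fun x => by
      refine (Finset.sum_le_card_nsmul _ _ M fun j _ => hM _).trans_eq ?_
      simp
    have hle := Finset.sum_le_card_nsmul {k ∈ P | k.2 = v}
      (fun k => Real.exp (birk T g n (y k))) (Real.exp (n * M))
      fun k _ => Real.exp_le_exp.2 (hbirk _)
    rw [nsmul_eq_mul] at hle
    have hk : (0 : ℝ) < Fintype.card ι := by exact_mod_cast Fintype.card_pos
    refine (Real.log_le_log (hpos v hv)
      (hle.trans (mul_le_mul_of_nonneg_right hcard (Real.exp_pos _).le))).trans_eq ?_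
    rw [Real.log_mul (by positivity) (by positivity), Real.log_pow, Real.log_exp]
    ring
  have hsum1 : ∑ v, μ.real (itinerary T c m ⁻¹' {v}) = 1 := by
    rw [sum_measureReal_preimage_singleton _ fun v _ => hψ v]
    simp
  have hadd := labelEntropy_itinerary_add_le (μ := μ) hT.measurable hc n m
  have hfin := le_sum_filter_mul_of_le_sum_mul (A := A) (t := t) (fun v => measureReal_nonneg)
    hsum1 hB (by linarith)
  rw [sum_measureReal_preimage_singleton _ fun v _ => hψ v] at hfin
  refine ⟨_, hfin, fun v hv => ⟨Finset.univ.filter fun w => (w, v) ∈ P, fun w => y (w, v), fun w hw => ?_, fun w hw => ?_,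
    ?_⟩⟩
  · exact hy2 (w, v) (Finset.mem_filter.1 hw).2
  · exact hy1 (w, v) (Finset.mem_filter.1 hw).2
  · simp only [Finset.mem_filter, Finset.mem_univ, true_and] at hv
    refine ((Real.le_log_iff_exp_le (hpos v hv.1)).1 hv.2).trans_eq ?_
    refine Finset.sum_nbij' Prod.fst (fun w => (w, v)) ?_ ?_ ?_ ?_ ?_ <;> aesop

/-- A finite measurable labelling is locally constant at a uniform scale off a set of small
measure. -/
theorem exists_small_compl_uniform_label {X : Type*} [MetricSpace X] [CompactSpace X]
    [MeasurableSpace X] [BorelSpace X] (μ : Measure X) [IsProbabilityMeasure μ] {ι : Type*}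
    [Fintype ι] {c : X → ι} (hc : ∀ a, MeasurableSet (c ⁻¹' {a})) {θ : ℝ} (hθ : 0 < θ) :
    ∃ U : Set X, MeasurableSet U ∧ μ.real U ≤ θ ∧ ∃ δ > 0, ∀ x y, x ∉ U → y ∉ U →
      dist x y ≤ δ → c x = c y := by
  have hθ' : ENNReal.ofReal (θ / (Fintype.card ι + 1)) ≠ 0 := by
    simp only [ne_eq, ENNReal.ofReal_eq_zero, not_le]
    positivity
  choose K hKc hK hKμ using fun a => (hc a).exists_isCompact_sdiff_lt (measure_ne_top μ _) hθ'
  have hKm : MeasurableSet (⋃ a, K a) := MeasurableSet.iUnion fun a => (hK a).measurableSet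
  have hKc' : ∀ a, ∀ x ∈ K a, c x = a := fun a x hx => hKc a hx
  refine ⟨(⋃ a, K a)ᶜ, hKm.compl, ?_, ?_⟩
  · have hsub : (⋃ a, K a)ᶜ ⊆ ⋃ a, c ⁻¹' {a} \ K a := fun x hx => by
      simp only [mem_compl_iff, mem_iUnion, not_exists] at hx
      exact mem_iUnion.2 ⟨c x, rfl, hx _⟩
    refine (measureReal_mono hsub).trans ((measureReal_iUnion_fintype_le _).trans ?_)
    refine (Finset.sum_le_card_nsmul _ _ (θ / (Fintype.card ι + 1)) fun a _ => ?_).trans ?_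
    · exact ENNReal.toReal_le_of_le_ofReal (by positivity) (hKμ a).le
    · rw [nsmul_eq_mul, Finset.card_univ, ← mul_div_assoc, div_le_iff₀ (by positivity)]
      nlinarith
  · set D : Set (X × X) := ⋃ a, ⋃ b, ⋃ _ : a ≠ b, K a ×ˢ K b with hD
    have hDc : IsCompact D := isCompact_iUnion fun a => isCompact_iUnion fun b =>
      isCompact_iUnion fun _ => (hK a).prod (hK b)
    have hDmem : ∀ x y, x ∉ (⋃ a, K a)ᶜ → y ∉ (⋃ a, K a)ᶜ → c x ≠ c y → (x, y) ∈ D := by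
      intro x y hx hy hxy
      rw [notMem_compl_iff, mem_iUnion] at hx hy
      obtain ⟨a, ha⟩ := hx
      obtain ⟨b, hb⟩ := hy
      rw [hKc' a x ha, hKc' b y hb] at hxy
      exact mem_iUnion.2 ⟨a, mem_iUnion.2 ⟨b, mem_iUnion.2 ⟨hxy, ha, hb⟩⟩⟩
    rcases D.eq_empty_or_nonempty with h | h
    · refine ⟨1, one_pos, fun x y hx hy _ => ?_⟩
      by_contra hxy
      simpa [h] using hDmem x y hx hy hxy
    · obtain ⟨z, hz, hmin⟩ := hDc.exists_isMinOn h continuous_dist.continuousOn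
      have hz0 : 0 < dist z.1 z.2 := by
        rw [dist_pos]
        intro hzz
        simp only [hD, mem_iUnion, mem_prod] at hz
        obtain ⟨a, b, hab, h1, h2⟩ := hz
        exact hab (by rw [← hKc' a _ h1, ← hKc' b _ h2, hzz])
      refine ⟨dist z.1 z.2 / 2, half_pos hz0, fun x y hx hy hd => ?_⟩
      by_contra hxy
      have : dist z.1 z.2 ≤ dist x y := hmin (hDmem x y hx hy hxy)
      linarith

end Measure

section Separated

variable [MetricSpace X]

/-- Passing from points with distinct itineraries to a separated subset. The potential is lowered
by `L` on a set `U` off which the labelling `c` is locally constant at scale `2 δ`. -/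
theorem exists_separated_sum_exp_le {ι κ : Type*} [Fintype ι] {T : X → X} {c : X → ι}
    {f : X → ℝ} {U : Set X} {δ η L : ℝ} (hL : 0 ≤ L)
    (hLη : Fintype.card ι * Real.exp (-L) ≤ η)
    (hU : ∀ x y, x ∉ U → y ∉ U → dist x y ≤ 2 * δ → c x = c y) (hδ : 0 < δ)
    (hf : ∀ x y, dist x y ≤ δ → f x ≤ f y + η) {n : ℕ} (W : Finset κ) (y : κ → X)
    (hinj : InjOn (fun k => itinerary T c n (y k)) (W : Set κ)) :
    ∃ S : Finset κ, S ⊆ W ∧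
      (∀ j ∈ S, ∀ k ∈ S, j ≠ k → ∃ i < n, δ < dist (T^[i] (y j)) (T^[i] (y k))) ∧
      ∑ k ∈ W, Real.exp (birk T (fun x => f x - U.indicator (fun _ => L) x) n (y k)) ≤
        Real.exp (n * (2 * η)) * ∑ k ∈ S, Real.exp (birk T f n (y k)) := by
  classical
  set Sep : Finset κ → Prop := fun S =>
    ∀ j ∈ S, ∀ k ∈ S, j ≠ k → ∃ i < n, δ < dist (T^[i] (y j)) (T^[i] (y k)) with hSep
  obtain ⟨S, hS, hmax⟩ := Finset.exists_max_image (W.powerset.filter Sep) Finset.card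
    ⟨∅, by simp [hSep]⟩
  rw [Finset.mem_filter, Finset.mem_powerset] at hS
  refine ⟨S, hS.1, hS.2, ?_⟩
  have hex : ∀ k, ∃ e, k ∈ W → e ∈ S ∧ ∀ i < n, dist (T^[i] (y k)) (T^[i] (y e)) ≤ δ := by
    intro k
    by_contra hcon
    push Not at hcon
    have hkW : k ∈ W := (hcon k).1
    have hcon' : ∀ e ∈ S, ∃ i < n, δ < dist (T^[i] (y k)) (T^[i] (y e)) := fun e he =>
      (hcon e).2 he
    have hkS : k ∉ S := fun hk => by
      obtain ⟨i, -, hi⟩ := hcon' k hk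
      rw [dist_self] at hi
      linarith
    have hins : insert k S ∈ W.powerset.filter Sep := by
      rw [Finset.mem_filter, Finset.mem_powerset]
      refine ⟨Finset.insert_subset hkW hS.1, fun a ha b hb hab => ?_⟩
      rcases Finset.mem_insert.1 ha with rfl | ha' <;>
        rcases Finset.mem_insert.1 hb with rfl | hb'
      · exact absurd rfl hab
      · exact hcon' b hb'
      · obtain ⟨i, hi, h⟩ := hcon' a ha'
        exact ⟨i, hi, by rwa [dist_comm]⟩
      · exact hS.2 a ha' b hb' hab
    have := hmax _ hins
    rw [Finset.card_insert_of_notMem hkS] at this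
    omega
  choose e he using hex
  rw [← Finset.sum_fiberwise_of_maps_to (fun k hk => (he k hk).1), Finset.mul_sum]
  refine Finset.sum_le_sum fun s _ => ?_
  set F : Finset κ := {k ∈ W | e k = s} with hF
  have hFW : ∀ k ∈ F, k ∈ W := fun k hk => (Finset.mem_filter.1 hk).1
  have hFd : ∀ k ∈ F, ∀ i < n, dist (T^[i] (y k)) (T^[i] (y s)) ≤ δ := fun k hk => by
    have := (he k (hFW k hk)).2
    rwa [(Finset.mem_filter.1 hk).2] at this
  have hsym : ∀ i : Fin n, ∃ a : ι, ∀ k ∈ F, T^[i] (y k) ∉ U → c (T^[i] (y k)) = a := by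
    intro i
    by_cases h : ∃ k ∈ F, T^[i] (y k) ∉ U
    · obtain ⟨k, hk, hkU⟩ := h
      refine ⟨c (T^[i] (y k)), fun j hj hjU => hU _ _ hjU hkU ?_⟩
      linarith [dist_triangle_right (T^[i] (y j)) (T^[i] (y k)) (T^[i] (y s)),
        hFd j hj i i.2, hFd k hk i i.2]
    · push Not at h
      exact ⟨c (T^[i] (y s)), fun k hk hkU => absurd (h k hk) hkU⟩
  choose a ha using hsym
  set ω : Fin n → ι → ℝ := fun i b => if b = a i then 1 else Real.exp (-L) with hω
  have hω0 : ∀ i b, 0 ≤ ω i b := fun i b => by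
    simp only [hω]
    split_ifs <;> positivity
  have hterm : ∀ k ∈ F,
      Real.exp (birk T (fun x => f x - U.indicator (fun _ => L) x) n (y k)) ≤
        Real.exp (birk T f n (y s) + n * η) * ∏ i, ω i (itinerary T c n (y k) i) := by
    intro k hk
    rw [birk, birk, Finset.sum_range, Finset.sum_range,
      show (∑ i : Fin n, f (T^[i] (y s))) + n * η = ∑ i : Fin n, (f (T^[i] (y s)) + η) by
        simp [Finset.sum_add_distrib], Real.exp_sum, Real.exp_sum, ← Finset.prod_mul_distrib]
    refine Finset.prod_le_prod (fun i _ => (Real.exp_pos _).le) fun i _ => ?_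
    rw [sub_eq_add_neg, Real.exp_add]
    refine mul_le_mul (Real.exp_le_exp.2 (hf _ _ (hFd k hk i i.2))) ?_ (Real.exp_pos _).le
      (Real.exp_pos _).le
    by_cases hkU : T^[i] (y k) ∈ U
    · rw [indicator_of_mem hkU]
      simp only [hω]
      split_ifs
      · simpa using hL
      · exact le_rfl
    · rw [indicator_of_notMem hkU]
      have : itinerary T c n (y k) i = a i := ha i k hk hkU
      simp [hω, this]
  have hη : 0 ≤ η := le_trans (by positivity) hLη
  have hprod : ∑ k ∈ F, ∏ i, ω i (itinerary T c n (y k) i) ≤ Real.exp (n * η) := by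
    have hinjF : InjOn (fun k => itinerary T c n (y k)) (F : Set κ) :=
      hinj.mono fun k hk => hFW k hk
    rw [← Finset.sum_image (f := fun w : Fin n → ι => ∏ i, ω i (w i)) hinjF]
    refine (Finset.sum_le_univ_sum_of_nonneg fun w =>
      Finset.prod_nonneg fun i _ => hω0 i _).trans ?_
    rw [← Fintype.piFinset_univ, ← Finset.prod_univ_sum, Real.exp_nat_mul,
      ← Fin.prod_const]
    refine Finset.prod_le_prod (fun i _ => Finset.sum_nonneg fun b _ => hω0 i b) fun i _ => ?_
    have h1 : ∀ b ∈ Finset.univ, ω i b ≤ (if b = a i then 1 else 0) + Real.exp (-L) := by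
      intro b _
      have := Real.exp_pos (-L)
      simp only [hω]
      split_ifs <;> linarith
    refine (Finset.sum_le_sum h1).trans ?_
    rw [Finset.sum_add_distrib, Finset.sum_const, Finset.card_univ, nsmul_eq_mul]
    simp only [Finset.sum_ite_eq', Finset.mem_univ, if_true]
    linarith [Real.add_one_le_exp η]
  refine (Finset.sum_le_sum hterm).trans ?_
  rw [← Finset.mul_sum]
  refine (mul_le_mul_of_nonneg_left hprod (Real.exp_pos _).le).trans_eq ?_
  rw [← Real.exp_add, ← Real.exp_add]
  congr 1
  ring

/-- There is a separated set in `K` whose exponential sum is at least `r`. -/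
def HasSeparatedSum (T : X → X) (f : X → ℝ) (n : ℕ) (δ : ℝ) (K : Set X) (r : ℝ) : Prop :=
  ∃ E : Finset X, ↑E ⊆ K ∧
    (∀ x ∈ E, ∀ y ∈ E, x ≠ y → ∃ i < n, δ < dist (T^[i] x) (T^[i] y)) ∧
    r ≤ ∑ x ∈ E, Real.exp (birk T f n x)

theorem continuous_birk {T : X → X} (hT : Continuous T) {f : X → ℝ} (hf : Continuous f) (n : ℕ) :
    Continuous (birk T f n) :=
  continuous_finsetSum _ fun j _ => hf.comp (hT.iterate j)

/-- Exponential growth at rate `C` of separated sums along the preimages of the `ε`-stable set. -/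
def StableGrowth (T : X → X) (f : X → ℝ) (ε δ C : ℝ) (x : X) : Prop :=
  ∃ᶠ n : ℕ in atTop, HasSeparatedSum T f n δ (T^[n] ⁻¹' epsStable T ε x) (Real.exp (n * C))

theorem StableGrowth.mono {T : X → X} {f : X → ℝ} {ε ε' δ C : ℝ} (hε : ε ≤ ε') {x : X}
    (h : StableGrowth T f ε δ C x) : StableGrowth T f ε' δ C x :=
  Frequently.mono h fun _ ⟨E, hE, h'⟩ => ⟨E, fun _ hy i => (hE hy i).trans hε, h'⟩

variable [CompactSpace X]

theorem hasSeparatedSum_preimage_epsStable {κ : Type*} [Fintype κ] {T : X → X}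
    (hT : Continuous T) {f : X → ℝ} (hf : Continuous f) {n : ℕ} {δ δ' ε r : ℝ} (hδ' : 0 < δ')
    (hδ : δ' < δ) {x : X}
    (h : ∃ᶠ m in atTop, ∃ (S : Finset κ) (y : κ → X),
      (∀ k ∈ S, ∀ i < m, dist (T^[i] x) (T^[i] (T^[n] (y k))) ≤ ε) ∧
      (∀ j ∈ S, ∀ k ∈ S, j ≠ k → ∃ i < n, δ < dist (T^[i] (y j)) (T^[i] (y k))) ∧
      r ≤ ∑ k ∈ S, Real.exp (birk T f n (y k))) :
    HasSeparatedSum T f n δ' (T^[n] ⁻¹' epsStable T ε x) r := by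
  classical
  set Z : Finset κ → ℕ → Set (κ → X) := fun S m => {y |
      (∀ k ∈ S, ∀ i < m, dist (T^[i] x) (T^[i] (T^[n] (y k))) ≤ ε) ∧
      (∀ j ∈ S, ∀ k ∈ S, j ≠ k → ∃ i < n, δ ≤ dist (T^[i] (y j)) (T^[i] (y k))) ∧
      r ≤ ∑ k ∈ S, Real.exp (birk T f n (y k))} with hZ
  have hanti : ∀ S, Antitone (Z S) := fun S m m' hm y hy =>
    ⟨fun k hk i hi => hy.1 k hk i (hi.trans_le hm), hy.2⟩
  have hclosed : ∀ S m, IsClosed (Z S m) := by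
    intro S m
    have hTi : ∀ i k, Continuous fun y : κ → X => T^[i] (y k) := fun i k =>
      (hT.iterate i).comp (continuous_apply k)
    have h1 : ∀ k i, IsClosed {y : κ → X | dist (T^[i] x) (T^[i] (T^[n] (y k))) ≤ ε} := fun k i =>
      isClosed_le (continuous_const.dist ((hT.iterate i).comp (hTi n k))) continuous_const
    have h2 : ∀ j k i, IsClosed {y : κ → X | δ ≤ dist (T^[i] (y j)) (T^[i] (y k))} := fun j k i =>
      isClosed_le continuous_const ((hTi i j).dist (hTi i k))
    have h3 : IsClosed {y : κ → X | r ≤ ∑ k ∈ S, Real.exp (birk T f n (y k))} :=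
      isClosed_le continuous_const (continuous_finsetSum _ fun k _ =>
        Real.continuous_exp.comp ((continuous_birk hT hf n).comp (continuous_apply k)))
    have heq : Z S m =
        (⋂ k ∈ S, ⋂ i ∈ Finset.range m,
          {y : κ → X | dist (T^[i] x) (T^[i] (T^[n] (y k))) ≤ ε}) ∩
        ((⋂ j ∈ S, ⋂ k ∈ S, ⋂ _ : j ≠ k, ⋃ i ∈ Finset.range n,
          {y : κ → X | δ ≤ dist (T^[i] (y j)) (T^[i] (y k))}) ∩
        {y : κ → X | r ≤ ∑ k ∈ S, Real.exp (birk T f n (y k))}) := by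
      ext y
      simp [hZ]
    rw [heq]
    refine (isClosed_biInter fun k _ => isClosed_biInter fun i _ => h1 k i).inter
      ((isClosed_biInter fun j _ => isClosed_biInter fun k _ => isClosed_iInter fun _ => ?_).inter
        h3)
    exact (Finset.finite_toSet _).isClosed_biUnion fun i _ => h2 j k i
  obtain ⟨S, hS⟩ : ∃ S, ∀ m, (Z S m).Nonempty := by
    by_contra hcon
    push Not at hcon
    choose M hM using hcon
    obtain ⟨m, hm, S, y, h1, h2, h3⟩ := frequently_atTop.1 h (Finset.univ.sup M)
    have hy : y ∈ Z S m := ⟨h1, fun j hj k hk hjk =>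
      (h2 j hj k hk hjk).imp fun i hi => ⟨hi.1, hi.2.le⟩, h3⟩
    have := hanti S ((Finset.le_sup (Finset.mem_univ S)).trans hm) hy
    rw [hM S] at this
    exact this
  obtain ⟨y, hy⟩ := IsCompact.nonempty_iInter_of_sequence_nonempty_isCompact_isClosed (Z S)
    (fun m => hanti S m.le_succ) hS (hclosed S 0).isCompact (hclosed S)
  rw [mem_iInter] at hy
  have hsep := (hy 0).2.1
  have hinj : InjOn y (S : Set κ) := fun j hj k hk hjk => by
    by_contra hne
    obtain ⟨i, -, hi⟩ := hsep j hj k hk hne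
    rw [hjk, dist_self] at hi
    linarith
  refine ⟨S.image y, ?_, ?_, ?_⟩
  · intro z hz
    obtain ⟨k, hk, rfl⟩ := Finset.mem_image.1 (Finset.mem_coe.1 hz)
    exact fun i => (hy (i + 1)).1 k hk i i.lt_succ_self
  · intro u hu v hv huv
    obtain ⟨j, hj, rfl⟩ := Finset.mem_image.1 hu
    obtain ⟨k, hk, rfl⟩ := Finset.mem_image.1 hv
    obtain ⟨i, hi, hd⟩ := hsep j hj k hk fun hjk => huv (congrArg y hjk)
    exact ⟨i, hi, hδ.trans_le hd⟩
  · rw [Finset.sum_image hinj]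
    exact (hy 0).2.2

theorem exists_forall_card_separated_le {T : X → X} {δ : ℝ} (hδ : 0 < δ) (n : ℕ) :
    ∃ N : ℕ, ∀ E : Finset X,
      (∀ x ∈ E, ∀ y ∈ E, x ≠ y → ∃ i < n, δ < dist (T^[i] x) (T^[i] y)) → E.card ≤ N := by
  classical
  obtain ⟨t, -, ht, hcov⟩ := finite_cover_balls_of_compact (isCompact_univ (X := X)) (half_pos hδ)
  lift t to Finset X using ht
  have hex : ∀ x : X, ∃ p : t, dist x (p : X) < δ / 2 := fun x => by
    obtain ⟨p, hp, hx⟩ := mem_iUnion₂.1 (hcov (mem_univ x))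
    exact ⟨⟨p, hp⟩, hx⟩
  choose p hp using hex
  refine ⟨Fintype.card (Fin n → t), fun E hE => ?_⟩
  refine Finset.card_le_card_of_injOn (itinerary T p n) (fun _ _ => Finset.mem_univ _) ?_
  intro x hx y hy hxy
  by_contra hne
  obtain ⟨i, hi, hd⟩ := hE x hx y hy hne
  have hi' : p (T^[i] x) = p (T^[i] y) := congrFun hxy ⟨i, hi⟩
  have h1 := hp (T^[i] x)
  rw [hi'] at h1
  linarith [hp (T^[i] y), dist_triangle_right (T^[i] x) (T^[i] y) (p (T^[i] y))]

theorem HasSeparatedSum.le_sepPn {T : X → X} (hT : Continuous T) {f : X → ℝ} (hf : Continuous f)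
    {n : ℕ} {δ r : ℝ} (hδ : 0 < δ) {K : Set X} (h : HasSeparatedSum T f n δ K r) :
    r ≤ sepPn T f n δ K := by
  obtain ⟨E, hEK, hE, hr⟩ := h
  refine hr.trans (le_csSup ?_ ⟨E, hEK, hE, rfl⟩)
  obtain ⟨N, hN⟩ := exists_forall_card_separated_le (T := T) hδ n
  obtain ⟨B, hB⟩ := (isCompact_range (Real.continuous_exp.comp (continuous_birk hT hf n))).bddAbove
  refine ⟨N * max B 0, ?_⟩
  rintro _ ⟨E', -, hE', rfl⟩
  refine (Finset.sum_le_card_nsmul E' _ (max B 0) fun x _ =>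
    (hB (mem_range_self x)).trans (le_max_left _ _)).trans ?_
  rw [nsmul_eq_mul]
  have : (E'.card : ℝ) ≤ N := by exact_mod_cast hN E' hE'
  gcongr

theorem StableGrowth.le_Ps {T : X → X} (hT : Continuous T) {f : X → ℝ} (hf : Continuous f)
    {ε δ C : ℝ} (hδ : 0 < δ) {x : X} (h : StableGrowth T f ε δ C x) :
    (C : EReal) ≤ Ps T f x ε := by
  refine le_iSup₂_of_le δ hδ (le_limsup_of_frequently_le' ?_)
  refine (h.and_eventually (eventually_gt_atTop 0)).mono fun n hn => ?_
  have hn0 : (0 : ℝ) < n := by exact_mod_cast hn.2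
  have := Real.log_le_log (Real.exp_pos _) (hn.1.le_sepPn hT hf hδ)
  rw [Real.log_exp] at this
  rw [EReal.coe_le_coe_iff, le_div_iff₀ hn0]
  linarith

theorem StableGrowth.iterate {T : X → X} {f : X → ℝ} (hf : Continuous f) {ε δ C C' : ℝ}
    (hC : C' < C) {x : X} (h : StableGrowth T f ε δ C x) (k : ℕ) :
    StableGrowth T f ε δ C' (T^[k] x) := by
  obtain ⟨B, hB⟩ := (isCompact_range hf).bddBelow
  have hbirk : ∀ n z, birk T f n z + k * B ≤ birk T f (n + k) z := fun n z => by
    rw [birk, birk, Finset.sum_range_add]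
    have := Finset.card_nsmul_le_sum (Finset.range k) (fun j => f (T^[n + j] z)) B
      fun j _ => hB (mem_range_self _)
    rw [Finset.card_range, nsmul_eq_mul] at this
    linarith
  obtain ⟨N, hN⟩ := exists_nat_gt (k * (C' - B) / (C - C'))
  rw [div_lt_iff₀ (by linarith)] at hN
  refine (tendsto_add_atTop_nat k).frequently
    (p := fun n => HasSeparatedSum T f n δ (T^[n] ⁻¹' epsStable T ε (T^[k] x))
      (Real.exp (n * C'))) ?_
  refine (h.and_eventually (eventually_ge_atTop N)).mono fun n hn => ?_
  obtain ⟨⟨E, hEK, hE, hr⟩, hNn⟩ := hn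
  refine ⟨E, fun y hy i => ?_, fun u hu v hv huv => ?_, ?_⟩
  · have := hEK hy (i + k)
    rwa [Function.iterate_add_apply, ← Function.iterate_add_apply T _ n,
      show i + k + n = i + (n + k) by ring, Function.iterate_add_apply T i (n + k)] at this
  · obtain ⟨i, hi, hd⟩ := hE u hu v hv huv
    exact ⟨i, by omega, hd⟩
  · have h1 : (N : ℝ) * (C - C') ≤ n * (C - C') := by
      have : (N : ℝ) ≤ n := by exact_mod_cast hNn
      have : 0 < C - C' := by linarith
      gcongr
    calc Real.exp ((n + k : ℕ) * C') ≤ Real.exp (n * C) * Real.exp (k * B) := by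
          rw [← Real.exp_add, Real.exp_le_exp]
          push_cast
          linarith
      _ ≤ (∑ z ∈ E, Real.exp (birk T f n z)) * Real.exp (k * B) := by gcongr
      _ ≤ ∑ z ∈ E, Real.exp (birk T f (n + k) z) := by
          rw [Finset.sum_mul]
          refine Finset.sum_le_sum fun z _ => ?_
          rw [← Real.exp_add, Real.exp_le_exp]
          exact hbirk n z

end Separated

section Main

variable [MetricSpace X] [CompactSpace X] [MeasurableSpace X] [BorelSpace X]

theorem exists_stableGrowth {μ : Measure X} [IsProbabilityMeasure μ] {T : X → X}
    (hTc : Continuous T) (hT : MeasurePreserving T μ μ) {f : X → ℝ} (hf : Continuous f)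
    {ι : Type*} [Fintype ι] {c : X → ι} (hc : ∀ a, MeasurableSet (c ⁻¹' {a})) {ε : ℝ}
    (hcε : ∀ x y, c x = c y → dist x y ≤ ε) {h : ℝ}
    (hent : ∀ n : ℕ, (n + 1) * h ≤ labelEntropy μ (itinerary T c (n + 1))) {η : ℝ} (hη : 0 < η) :
    ∃ δ > 0, ∃ G : Set X, MeasurableSet G ∧ 0 < μ G ∧
      ∀ x ∈ G, StableGrowth T f ε δ (h + ∫ x, f x ∂μ - 5 * η) x := by
  set I := ∫ x, f x ∂μ with hI
  have hfint : Integrable f μ := hf.integrable_of_hasCompactSupport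
    (HasCompactSupport.of_compactSpace f)
  obtain ⟨M, hM⟩ := (isCompact_range hf).bddAbove
  obtain ⟨L, hL, hLη⟩ : ∃ L : ℝ, 0 ≤ L ∧ Fintype.card ι * Real.exp (-L) ≤ η := by
    refine ⟨Real.log (Fintype.card ι / η + 1), Real.log_nonneg ?_, ?_⟩
    · have : 0 ≤ Fintype.card ι / η := by positivity
      linarith
    · rw [Real.exp_neg, Real.exp_log (by positivity), ← div_eq_mul_inv,
        div_le_iff₀ (by positivity), mul_add, mul_div_cancel₀ _ hη.ne']
      linarith
  obtain ⟨U, hUm, hUμ, δ₀, hδ₀, hU⟩ := exists_small_compl_uniform_label μ hc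
    (θ := η / (L + 1)) (by positivity)
  obtain ⟨δ₁, hδ₁, hfδ⟩ := Metric.uniformContinuous_iff.1
    (CompactSpace.uniformContinuous_of_continuous hf) η hη
  set δ := min (δ₀ / 2) (δ₁ / 2) with hδdef
  have hδ : 0 < δ := by positivity
  have hδ₀' : δ ≤ δ₀ / 2 := min_le_left _ _
  have hδ₁' : δ ≤ δ₁ / 2 := min_le_right _ _
  have hU' : ∀ x y, x ∉ U → y ∉ U → dist x y ≤ 2 * δ → c x = c y := fun x y hx hy hd =>
    hU x y hx hy (by linarith)
  have hf' : ∀ x y, dist x y ≤ δ → f x ≤ f y + η := fun x y hd => by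
    have := hfδ (a := x) (b := y) (by linarith)
    rw [Real.dist_eq] at this
    linarith [le_abs_self (f x - f y)]
  set g : X → ℝ := fun x => f x - U.indicator (fun _ => L) x with hg
  have hUint : Integrable (U.indicator fun _ => L) μ := (integrable_const L).indicator hUm
  have hgint : Integrable g μ := hfint.sub hUint
  have hgI : I - η ≤ ∫ x, g x ∂μ := by
    rw [hg, integral_sub hfint hUint, integral_indicator_const _ hUm, smul_eq_mul]
    have h1 : μ.real U * L ≤ η / (L + 1) * L := by gcongr
    have h2 : η / (L + 1) * L ≤ η := by
      rw [div_mul_eq_mul_div, div_le_iff₀ (by positivity)]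
      nlinarith
    linarith
  have hgM : ∀ x, g x ≤ M := fun x => by
    have h1 := hM (mem_range_self x)
    have h2 : 0 ≤ U.indicator (fun _ => L) x := indicator_nonneg (fun _ _ => hL) x
    simp only [hg]
    linarith
  set R := Real.log (Fintype.card ι) + M - (h + I - 3 * η) with hR
  set p := ENNReal.ofReal (η / (|R| + 1)) with hp
  have hp0 : 0 < p := by
    rw [hp, ENNReal.ofReal_pos]
    positivity
  have hstep : ∀ n : ℕ, 0 < n → ∃ G : Set X, MeasurableSet G ∧ p ≤ μ G ∧ ∀ x ∈ G,
      HasSeparatedSum T f n (δ / 2) (T^[n] ⁻¹' epsStable T ε x)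
        (Real.exp (n * (h + I - 5 * η))) := by
    intro n hn
    have hn0 : (0 : ℝ) < n := by exact_mod_cast hn
    have hfreq := frequently_le_sub_of_mul_le
      (a := fun N => labelEntropy μ (itinerary T c N)) hη hent hn
    have hex : ∀ m : ℕ, ∃ V : Finset (Fin m → ι),
        (n * (h - η) ≤ labelEntropy μ (itinerary T c (n + m)) - labelEntropy μ (itinerary T c m) →
          p ≤ μ (itinerary T c m ⁻¹' V)) ∧
        ∀ v ∈ V, ∃ (S : Finset (Fin n → ι)) (y : (Fin n → ι) → X),
          (∀ k ∈ S, itinerary T c m (T^[n] (y k)) = v) ∧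
          (∀ j ∈ S, ∀ k ∈ S, j ≠ k → ∃ i < n, δ < dist (T^[i] (y j)) (T^[i] (y k))) ∧
          Real.exp (n * (h + I - 5 * η)) ≤ ∑ k ∈ S, Real.exp (birk T f n (y k)) := by
      intro m
      by_cases hm : n * (h - η) ≤
        labelEntropy μ (itinerary T c (n + m)) - labelEntropy μ (itinerary T c m)
      swap
      · exact ⟨∅, fun h' => absurd h' hm, by simp⟩
      obtain ⟨V, hV, hVS⟩ := exists_itineraries_sum_exp_ge hT hc hgint hgM n m
        (A := n * (h + I - 2 * η)) (t := n * η) (by nlinarith)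
      refine ⟨V, fun _ => ?_, fun v hv => ?_⟩
      · refine ENNReal.ofReal_le_of_le_toReal ?_
        rw [div_le_iff₀ (by positivity)]
        have h1 : n * η ≤ n * (μ.real (itinerary T c m ⁻¹' V) * R) := hV.trans_eq (by
          rw [hR]
          ring)
        have h2 := le_of_mul_le_mul_left h1 hn0
        refine h2.trans (mul_le_mul_of_nonneg_left ?_ measureReal_nonneg)
        linarith [le_abs_self R]
      · obtain ⟨W, y, hWv, hWw, hsum⟩ := hVS v hv
        obtain ⟨S, hSW, hsep, hSsum⟩ := exists_separated_sum_exp_le hL hLη hU' hδ hf' W y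
          fun j hj k hk hjk => (hWw j hj).symm.trans (hjk.trans (hWw k hk))
        refine ⟨S, y, fun k hk => hWv k (hSW hk), hsep, ?_⟩
        have h1 := hsum.trans hSsum
        rw [← div_le_iff₀' (Real.exp_pos _), ← Real.exp_sub] at h1
        refine (Real.exp_le_exp.2 ?_).trans h1
        linarith
    choose V hVp hVS using hex
    obtain ⟨hGm, hGp⟩ := le_measure_setOf_frequently (μ := μ) (p := p)
      (s := fun m => itinerary T c m ⁻¹' V m) (fun m => by
        rw [← Finset.set_biUnion_preimage_singleton]
        exact Finset.measurableSet_biUnion _ fun w _ =>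
          measurableSet_itinerary_preimage hT.measurable hc m w)
      (hfreq.mono fun m hm => hVp m hm)
    refine ⟨_, hGm, hGp, fun x hx => ?_⟩
    refine hasSeparatedSum_preimage_epsStable (κ := Fin n → ι) hTc hf (half_pos hδ)
      (half_lt_self hδ) ((hx : ∃ᶠ m in atTop, x ∈ itinerary T c m ⁻¹' V m).mono fun m hm => ?_)
    obtain ⟨S, y, hSv, hsep, hsum⟩ := hVS m _ hm
    exact ⟨S, y, fun k hk i hi => hcε _ _ (congrFun (hSv k hk).symm ⟨i, hi⟩), hsep, hsum⟩
  choose! G hGm hGp hG using hstep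
  obtain ⟨hm, hle⟩ := le_measure_setOf_frequently (μ := μ) (p := p) (s := fun n => G (n + 1))
    (fun n => hGm _ n.succ_pos) (Frequently.of_forall fun n => hGp _ n.succ_pos)
  refine ⟨δ / 2, half_pos hδ, _, hm, hp0.trans_le hle, fun x hx => ?_⟩
  exact (tendsto_add_atTop_nat 1).frequently (Frequently.mono hx fun n hn => hG _ n.succ_pos x hn)

theorem ae_le_Ps {μ : Measure X} [IsProbabilityMeasure μ] {T : X ≃ₜ X} (hT : Ergodic T μ)
    {f : X → ℝ} (hf : Continuous f) {ε δ C C' : ℝ} (hδ : 0 < δ) (hC : C' < C) {G : Set X}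
    (hG : MeasurableSet G) (hG0 : 0 < μ G) (hGx : ∀ x ∈ G, StableGrowth T f ε δ C x) :
    ∀ᵐ x ∂μ, ∀ ε' ≥ ε, (C' : EReal) ≤ Ps T f x ε' := by
  have hTc : Continuous T := T.continuous
  set A : Set X := ⋃ k : ℕ, T.symm^[k] ⁻¹' G with hA
  have hAm : MeasurableSet A := MeasurableSet.iUnion fun k =>
    T.symm.continuous.measurable.iterate k hG
  have hinv : ∀ (k : ℕ) (x : X), T^[k] (T.symm^[k] x) = x := fun k =>
    Function.LeftInverse.iterate T.apply_symm_apply k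
  have hAT : A ≤ᵐ[μ] T ⁻¹' A := by
    refine LE.le.eventuallyLE fun x hx => ?_
    obtain ⟨k, hk⟩ := mem_iUnion.1 hx
    refine mem_iUnion.2 ⟨k + 1, ?_⟩
    rw [mem_preimage, Function.iterate_succ_apply, T.symm_apply_apply]
    exact hk
  have hA1 : A =ᵐ[μ] univ := by
    refine (hT.ae_empty_or_univ_of_ae_le_preimage hAm.nullMeasurableSet hAT).resolve_left
      fun h => ?_
    rw [ae_eq_empty] at h
    exact hG0.ne' (measure_mono_null (subset_iUnion_of_subset 0 subset_rfl) h)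
  filter_upwards [eventuallyEq_univ.1 hA1] with x hx ε' hε
  obtain ⟨k, hk⟩ := mem_iUnion.1 hx
  have := (hGx _ hk).iterate hf hC k
  rw [hinv] at this
  exact (this.mono hε).le_Ps hTc hf hδ

theorem ae_le_Ps_of_lt_mPres {μ : Measure X} [IsProbabilityMeasure μ] {T : X ≃ₜ X}
    (hT : Ergodic T μ) {f : X → ℝ} (hf : Continuous f) {ε : ℝ} (hε : 0 < ε) {r : ℝ}
    (hr : (r : EReal) < mPres μ T f) : ∀ᵐ x ∂μ, ∀ ε' ≥ ε, (r : EReal) ≤ Ps T f x ε' := by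
  obtain ⟨α, hα, hlt⟩ : ∃ α : Finset (Set X), IsFinPartition α ∧
      r < entPart μ T α + ∫ x, f x ∂μ := by
    rw [mPres] at hr
    have h1 : ((r - ∫ x, f x ∂μ : ℝ) : EReal) < mEnt μ T := by
      rw [EReal.coe_sub]
      exact EReal.sub_lt_of_lt_add hr
    rw [mEnt, lt_iSup_iff] at h1
    obtain ⟨α, h2⟩ := h1
    rw [lt_iSup_iff] at h2
    obtain ⟨hα, h3⟩ := h2
    rw [EReal.coe_lt_coe_iff] at h3
    exact ⟨α, hα, by linarith⟩
  obtain ⟨ι, _, c, hc, hcε, hent⟩ := exists_refined_labelling (μ := μ) hT.measurable hα hε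
  set η := (entPart μ T α + ∫ x, f x ∂μ - r) / 6 with hη
  obtain ⟨δ, hδ, G, hG, hG0, hGx⟩ := exists_stableGrowth T.continuous hT.toMeasurePreserving hf
    hc hcε hent (η := η) (by linarith)
  exact ae_le_Ps hT hf hδ (by linarith) hG hG0 hGx

end Main

/-- For a TDS `(X,T)`, `f ∈ C(X,ℝ)` and an ergodic `T`-invariant
Borel probability measure `μ` with `h_μ(T) > 0`: for `μ`-a.e. `x`,
`lim_{ε→0} P_s(T,f,x,ε) ≥ P_μ(T,f)` (the limit being the infimum over `ε > 0`,
since `ε ↦ P_s(T,f,x,ε)` is nondecreasing). -/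
theorem stmt6 [MetricSpace X] [CompactSpace X] [MeasurableSpace X] [BorelSpace X]
    (T : X ≃ₜ X) (f : C(X, ℝ)) (μ : Measure X) [IsProbabilityMeasure μ]
    (herg : Ergodic ⇑T μ) (hpos : 0 < mEnt μ ⇑T) :
    ∀ᵐ x ∂μ, mPres μ ⇑T ⇑f ≤ ⨅ (ε : ℝ) (_ : 0 < ε), Ps ⇑T ⇑f x ε := by
  have hk : ∀ᵐ x ∂μ, ∀ (k : ℕ) (q : ℚ), ((q : ℝ) : EReal) < mPres μ T f →
      ∀ ε' ≥ 1 / ((k : ℝ) + 1), ((q : ℝ) : EReal) ≤ Ps T f x ε' := by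
    refine ae_all_iff.2 fun k => ae_all_iff.2 fun q => ?_
    by_cases hq : ((q : ℝ) : EReal) < mPres μ T f
    · filter_upwards [ae_le_Ps_of_lt_mPres herg f.continuous (Nat.one_div_pos_of_nat (n := k)) hq]
        with x hx _
      exact hx
    · exact .of_forall fun x h => absurd h hq
  filter_upwards [hk] with x hx
  refine le_iInf₂ fun ε hε => le_of_not_gt fun hlt => ?_
  obtain ⟨q, hPq, hq⟩ := EReal.lt_iff_exists_rat_btwn.1 hlt
  obtain ⟨k, hkε⟩ := exists_nat_one_div_lt hε
  exact (hx k q hq ε hkε.le).not_gt hPq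
end
end

section
/- Let (X,T) be a topological dynamical system (with T either a homeomorphism or a surjective continuous map) and f ∈ C(X,ℝ). Then for every ε > 0, sup_{x∈X} P_s(T,f,x,ε) = P(T,f). -/
open Filter Set Topology MeasureTheory

noncomputable section

variable {X : Type*}

/-- `E` is `(n,δ)`-separated for `T`. -/
def IsDynSep [MetricSpace X] (T : X → X) (n : ℕ) (δ : ℝ) (E : Finset X) : Prop :=
  ∀ x ∈ E, ∀ y ∈ E, x ≠ y → ∃ i < n, δ < dist (T^[i] x) (T^[i] y)

theorem IsDynSep.anti [MetricSpace X] {T : X → X} {n : ℕ} {δ δ' : ℝ} {E : Finset X}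
    (h : IsDynSep T n δ E) (hδ : δ' ≤ δ) : IsDynSep T n δ' E := by
  intro x hx y hy hxy
  obtain ⟨i, hi, hd⟩ := h x hx y hy hxy
  exact ⟨i, hi, hδ.trans_lt hd⟩

theorem birk_add (T : X → X) (f : X → ℝ) (m k : ℕ) (x : X) :
    birk T f (m + k) x = birk T f m x + birk T f k (T^[m] x) := by
  unfold birk
  rw [Finset.sum_range_add]
  congr 1
  refine Finset.sum_congr rfl fun j _ => ?_
  rw [← Function.iterate_add_apply, add_comm]

theorem isOpen_dynBall [MetricSpace X] {T : X → X} (hT : Continuous T) (n : ℕ) (r : ℝ) (c : X) :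
    IsOpen {y | ∀ i < n, dist (T^[i] y) (T^[i] c) < r} := by
  have : {y | ∀ i < n, dist (T^[i] y) (T^[i] c) < r} =
      ⋂ i ∈ Finset.range n, {y | dist (T^[i] y) (T^[i] c) < r} := by
    ext y; simp
  rw [this]
  exact isOpen_biInter_finset fun i _ =>
    isOpen_lt ((hT.iterate i).dist continuous_const) continuous_const

theorem isClosed_dynBall [MetricSpace X] {T : X → X} (hT : Continuous T) (n : ℕ) (r : ℝ) (c : X) :
    IsClosed {y | ∀ i < n, dist (T^[i] y) (T^[i] c) ≤ r} := by
  simp only [ofPred_forall]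
  exact isClosed_iInter fun i => isClosed_iInter fun _ =>
    isClosed_le ((hT.iterate i).dist continuous_const) continuous_const

/-- A compact space is covered by finitely many dynamical balls, whose lengths may depend on
their centres. -/
theorem exists_finset_dynBall_cover [MetricSpace X] [CompactSpace X] {T : X → X}
    (hT : Continuous T) (N : X → ℕ) {r : ℝ} (hr : 0 < r) :
    ∃ s : Finset X, ∀ y, ∃ c ∈ s, ∀ i < N c, dist (T^[i] y) (T^[i] c) < r := by
  obtain ⟨s, -, hs⟩ := isCompact_univ.elim_nhds_subcover
    (fun c => {y : X | ∀ i < N c, dist (T^[i] y) (T^[i] c) < r})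
    (fun c _ => (isOpen_dynBall hT (N c) r c).mem_nhds (by simp [hr]))
  refine ⟨s, fun y => ?_⟩
  simpa using hs (mem_univ y)

theorem exists_card_le_of_isDynSep [MetricSpace X] [CompactSpace X] {T : X → X}
    (hT : Continuous T) (n : ℕ) {δ : ℝ} (hδ : 0 < δ) :
    ∃ k : ℕ, ∀ E : Finset X, IsDynSep T n δ E → E.card ≤ k := by
  obtain ⟨s, hs⟩ := exists_finset_dynBall_cover hT (fun _ => n) (half_pos hδ)
  choose c hcs hc using hs
  refine ⟨s.card, fun E hE => Finset.card_le_card_of_injOn c (fun x _ => hcs x) ?_⟩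
  intro x hx y hy hxy
  by_contra hne
  obtain ⟨i, hi, hd⟩ := hE x hx y hy hne
  have h1 := hc x i hi
  have h2 := hc y i hi
  rw [← hxy] at h2
  have := dist_triangle_right (T^[i] x) (T^[i] y) (T^[i] (c x))
  linarith

theorem birk_le [MetricSpace X] [CompactSpace X] (T : X → X) (f : C(X, ℝ)) (n : ℕ) (x : X) :
    birk T f n x ≤ n * ‖f‖ := by
  unfold birk
  calc _ ≤ ∑ _j ∈ Finset.range n, ‖f‖ :=
        Finset.sum_le_sum fun j _ => (le_abs_self _).trans (f.norm_coe_le_norm _)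
    _ = _ := by simp

theorem bddAbove_sepPn [MetricSpace X] [CompactSpace X] {T : X → X} (hT : Continuous T)
    (f : C(X, ℝ)) (n : ℕ) {δ : ℝ} (hδ : 0 < δ) (K : Set X) :
    BddAbove { r : ℝ | ∃ E : Finset X, ↑E ⊆ K ∧
      (∀ x ∈ E, ∀ y ∈ E, x ≠ y → ∃ i < n, δ < dist (T^[i] x) (T^[i] y)) ∧
      r = ∑ x ∈ E, Real.exp (birk T f n x) } := by
  obtain ⟨k, hk⟩ := exists_card_le_of_isDynSep hT n hδ
  refine ⟨k * Real.exp (n * ‖f‖), ?_⟩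
  rintro r ⟨E, -, hE, rfl⟩
  calc _ ≤ ∑ _x ∈ E, Real.exp (n * ‖f‖) :=
        Finset.sum_le_sum fun x _ => Real.exp_le_exp.2 (birk_le T f n x)
    _ = E.card * Real.exp (n * ‖f‖) := by simp
    _ ≤ _ := by gcongr; exact hk E hE

theorem sum_le_sepPn [MetricSpace X] [CompactSpace X] {T : X → X} (hT : Continuous T)
    (f : C(X, ℝ)) {n : ℕ} {δ : ℝ} (hδ : 0 < δ) {K : Set X} {E : Finset X} (hEK : ↑E ⊆ K)
    (hE : IsDynSep T n δ E) : ∑ x ∈ E, Real.exp (birk T f n x) ≤ sepPn T f n δ K :=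
  le_csSup (bddAbove_sepPn hT f n hδ K) ⟨E, hEK, hE, rfl⟩

theorem sepPn_le [MetricSpace X] {T : X → X} {f : X → ℝ} {n : ℕ} {δ : ℝ} {K : Set X} {B : ℝ}
    (h : ∀ E : Finset X, ↑E ⊆ K → IsDynSep T n δ E → ∑ x ∈ E, Real.exp (birk T f n x) ≤ B) :
    sepPn T f n δ K ≤ B := by
  refine csSup_le ⟨0, ∅, by simp⟩ ?_
  rintro r ⟨E, hEK, hE, rfl⟩
  exact h E hEK hE

theorem sepPn_nonneg [MetricSpace X] (T : X → X) (f : X → ℝ) (n : ℕ) (δ : ℝ) (K : Set X) :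
    0 ≤ sepPn T f n δ K := by
  refine Real.sSup_nonneg ?_
  rintro r ⟨E, -, -, rfl⟩
  positivity

theorem sepPn_pos [MetricSpace X] [CompactSpace X] {T : X → X} (hT : Continuous T)
    (f : C(X, ℝ)) (n : ℕ) {δ : ℝ} (hδ : 0 < δ) {K : Set X} (hK : K.Nonempty) :
    0 < sepPn T f n δ K := by
  obtain ⟨x, hx⟩ := hK
  refine lt_of_lt_of_le ?_ (sum_le_sepPn (E := {x}) hT f hδ (by simpa using hx) ?_)
  · simp [Real.exp_pos]
  · intro a ha b hb hab
    simp_all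

theorem sepPn_mono [MetricSpace X] [CompactSpace X] {T : X → X} (hT : Continuous T)
    (f : C(X, ℝ)) (n : ℕ) {δ δ' : ℝ} (hδ : 0 < δ) (hδδ' : δ ≤ δ') {K K' : Set X} (hK : K ⊆ K') :
    sepPn T f n δ' K ≤ sepPn T f n δ K' :=
  sepPn_le fun _ hEK hE => sum_le_sepPn hT f hδ (hEK.trans hK) (hE.anti hδδ')

/-- A maximal separated subset of `K` spans `K`. -/
theorem exists_isDynSep_spanning [MetricSpace X] [CompactSpace X] {T : X → X}
    (hT : Continuous T) (n : ℕ) {δ : ℝ} (hδ : 0 < δ) (K : Set X) :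
    ∃ E : Finset X, ↑E ⊆ K ∧ IsDynSep T n δ E ∧
      ∀ y ∈ K, ∃ z ∈ E, ∀ i < n, dist (T^[i] y) (T^[i] z) ≤ δ := by
  classical
  obtain ⟨k, hk⟩ := exists_card_le_of_isDynSep hT n hδ
  let S : Set ℕ := {m | ∃ E : Finset X, ↑E ⊆ K ∧ IsDynSep T n δ E ∧ E.card = m}
  have hS : S.Nonempty := ⟨0, ∅, by simp [IsDynSep]⟩
  have hSb : BddAbove S := ⟨k, by rintro m ⟨E, -, hE, rfl⟩; exact hk E hE⟩
  obtain ⟨E, hEK, hE, hEc⟩ := Nat.sSup_mem hS hSb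
  refine ⟨E, hEK, hE, fun y hy => ?_⟩
  by_contra! hcon
  have hyE : y ∉ E := fun h => by
    obtain ⟨i, -, hi⟩ := hcon y h
    rw [dist_self] at hi
    exact hδ.not_gt hi
  have hmem : (insert y E).card ∈ S := by
    refine ⟨insert y E, ?_, ?_, rfl⟩
    · rw [Finset.coe_insert]; exact insert_subset hy hEK
    · intro a ha b hb hab
      rw [Finset.mem_insert] at ha hb
      rcases ha with rfl | ha <;> rcases hb with rfl | hb
      · exact absurd rfl hab
      · exact hcon b hb
      · obtain ⟨i, hi, hd⟩ := hcon a ha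
        exact ⟨i, hi, by rwa [dist_comm]⟩
      · exact hE a ha b hb hab
  have := le_csSup hSb hmem
  rw [Finset.card_insert_of_notMem hyE] at this
  omega

theorem sum_le_sum_sum_filter {ι : Type*} {s : Finset ι} {E : Finset X} {p : ι → X → Prop}
    [∀ c, DecidablePred (p c)]
    {g : X → ℝ} (hg : ∀ y, 0 ≤ g y) (h : ∀ y ∈ E, ∃ c ∈ s, p c y) :
    ∑ y ∈ E, g y ≤ ∑ c ∈ s, ∑ y ∈ E with p c y, g y := by
  simp_rw [Finset.sum_filter]
  rw [Finset.sum_comm]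
  refine Finset.sum_le_sum fun y hy => ?_
  obtain ⟨c, hc, hcy⟩ := h y hy
  have := Finset.single_le_sum (f := fun c => if p c y then g y else 0)
    (fun c _ => by split_ifs <;> simp [hg]) hc
  simpa only [hcy, if_true] using this

/-- A neighbourhood of `T^{-n} W^s_ε(x,T)` contains `T^{-n}` of a closed dynamical `ε`-ball
around `x`. -/
theorem exists_preimage_dynBall_subset [MetricSpace X] [CompactSpace X] {T : X → X}
    (hT : Continuous T) (n : ℕ) (ε : ℝ) (x : X) {U : Set X} (hU : IsOpen U)
    (h : T^[n] ⁻¹' epsStable T ε x ⊆ U) :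
    ∃ N : ℕ, T^[n] ⁻¹' {y | ∀ i < N, dist (T^[i] y) (T^[i] x) ≤ ε} ⊆ U := by
  refine exists_subset_nhds_of_compactSpace
    (V := fun N : ℕ => T^[n] ⁻¹' {y | ∀ i < N, dist (T^[i] y) (T^[i] x) ≤ ε}) ?_
    (fun N => (isClosed_dynBall hT N ε x).preimage (hT.iterate n)) ?_
  · refine directed_of_isDirected_le fun a b hab y hy i hi => hy i (hi.trans_le hab)
  · intro y hy
    refine hU.mem_nhds (h fun i => ?_)
    rw [dist_comm]
    exact mem_iInter.1 hy (i + 1) i i.lt_succ_self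

open scoped Classical in
/-- The separated weight at time `m + n` of a set whose image under `T^m` is covered by pieces
`B z` of dynamical `n`-balls is controlled by the weights at time `m` over the pieces. -/
theorem sum_exp_birk_le_of_cover [MetricSpace X] {T : X → X} {f : X → ℝ} {δ τ R : ℝ}
    (hτ : ∀ u v : X, dist u v < 2 * δ → f u ≤ f v + τ) {m n : ℕ} {S E : Finset X} {B : X → Set X}
    (hB : ∀ z, ∀ y ∈ B z, ∀ i < n, dist (T^[i] y) (T^[i] z) < 2 * δ)
    (hcover : ∀ y ∈ E, ∃ z ∈ S, T^[m] y ∈ B z) (hE : IsDynSep T (m + n) (4 * δ) E)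
    (hR : ∀ z, ∀ F : Finset X, ↑F ⊆ T^[m] ⁻¹' B z → IsDynSep T m (4 * δ) F →
      ∑ y ∈ F, Real.exp (birk T f m y) ≤ R) :
    ∑ y ∈ E, Real.exp (birk T f (m + n) y) ≤
      (∑ z ∈ S, Real.exp (birk T f n z)) * (Real.exp (n * τ) * R) := by
  refine (sum_le_sum_sum_filter (fun y => (Real.exp_pos (birk T f (m + n) y)).le) hcover).trans ?_
  rw [Finset.sum_mul]
  refine Finset.sum_le_sum fun z _ => ?_
  have hsep : IsDynSep T m (4 * δ) {y ∈ E | T^[m] y ∈ B z} := by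
    intro u hu v hv huv
    rw [Finset.mem_filter] at hu hv
    obtain ⟨i, hi, hd⟩ := hE u hu.1 v hv.1 huv
    refine ⟨i, ?_, hd⟩
    by_contra! hmi
    obtain ⟨j, rfl⟩ := Nat.exists_eq_add_of_le' hmi
    rw [Function.iterate_add_apply, Function.iterate_add_apply] at hd
    have h1 := hB z _ hu.2 j (by omega)
    have h2 := hB z _ hv.2 j (by omega)
    have := dist_triangle_right (T^[j] (T^[m] u)) (T^[j] (T^[m] v)) (T^[j] z)
    linarith
  have hsum := hR z {y ∈ E | T^[m] y ∈ B z} (fun y hy => (Finset.mem_filter.1 hy).2) hsep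
  calc _ ≤ ∑ y ∈ E with T^[m] y ∈ B z,
        Real.exp (birk T f n z + n * τ) * Real.exp (birk T f m y) := by
        refine Finset.sum_le_sum fun y hy => ?_
        rw [birk_add, ← Real.exp_add, Real.exp_le_exp, add_comm]
        gcongr
        unfold birk
        calc _ ≤ ∑ j ∈ Finset.range n, (f (T^[j] z) + τ) :=
              Finset.sum_le_sum fun j hj => hτ _ _
                (hB z _ (Finset.mem_filter.1 hy).2 j (Finset.mem_range.1 hj))
          _ = _ := by simp [Finset.sum_add_distrib]
    _ ≤ Real.exp (birk T f n z + n * τ) * R := by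
        rw [← Finset.mul_sum]; gcongr
    _ = _ := by rw [Real.exp_add, mul_assoc]

/-- If every point `x` has a time `n x ≥ 1` at which `T^{-n x} W^s_ε(x,T)` carries little
`(n x, δ)`-separated weight, then the separated weight of the whole space grows at rate at
most `b + τ`, where `τ` bounds the oscillation of `f` at scale `2δ`. -/
theorem exists_sepPn_le_of_forall_epsStable [MetricSpace X] [CompactSpace X] {T : X → X}
    (hT : Continuous T) (f : C(X, ℝ)) {ε δ b τ : ℝ} (hε : 0 < ε) (hδ : 0 < δ) (hδε : 8 * δ ≤ ε)
    (hτ : ∀ u v : X, dist u v < 2 * δ → f u ≤ f v + τ)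
    (h : ∀ x, ∃ n : ℕ, 1 ≤ n ∧
      sepPn T f n δ (T^[n] ⁻¹' epsStable T ε x) ≤ Real.exp (n * b)) :
    ∃ D : ℝ, 1 ≤ D ∧ ∀ n : ℕ, sepPn T f n (4 * δ) univ ≤ D * Real.exp (n * (b + τ)) := by
  classical
  choose n hn1 hn using h
  choose S hSK hSsep hSspan using fun x =>
    exists_isDynSep_spanning hT (n x) hδ (T^[n x] ⁻¹' epsStable T ε x)
  have hSsum : ∀ x, ∑ z ∈ S x, Real.exp (birk T f (n x) z) ≤ Real.exp (n x * b) := fun x =>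
    (sum_le_sepPn hT f hδ (hSK x) (hSsep x)).trans (hn x)
  have hN : ∀ x, ∃ N : ℕ, T^[n x] ⁻¹' {y | ∀ i < N, dist (T^[i] y) (T^[i] x) ≤ ε} ⊆
      ⋃ z ∈ S x, {y | ∀ i < n x, dist (T^[i] y) (T^[i] z) < 2 * δ} := by
    intro x
    refine exists_preimage_dynBall_subset hT (n x) ε x
      (isOpen_biUnion fun z _ => isOpen_dynBall hT (n x) (2 * δ) z) fun y hy => ?_
    obtain ⟨z, hz, hyz⟩ := hSspan x y hy
    exact mem_iUnion₂.2 ⟨z, hz, fun i hi => (hyz i hi).trans_lt (by linarith)⟩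
  choose N hN using hN
  obtain ⟨t, ht⟩ := exists_finset_dynBall_cover hT N (half_pos hε)
  let M := t.sup N
  let L := t.sup n
  let C : ℝ := ∑ k ∈ Finset.range L, sepPn T f k (4 * δ) univ * Real.exp (-(k * (b + τ)))
  have hC0 : 0 ≤ C := Finset.sum_nonneg fun k _ =>
    mul_nonneg (sepPn_nonneg _ _ _ _ _) (Real.exp_pos _).le
  have hC : ∀ k < L, sepPn T f k (4 * δ) univ ≤ C * Real.exp (k * (b + τ)) := by
    intro k hk
    have := Finset.single_le_sum (s := Finset.range L)
      (f := fun k : ℕ => sepPn T f k (4 * δ) univ * Real.exp (-(k * (b + τ))))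
      (fun k _ => mul_nonneg (sepPn_nonneg _ _ _ _ _) (Real.exp_pos _).le)
      (Finset.mem_range.2 hk)
    rw [Real.exp_neg] at this
    rwa [← div_eq_mul_inv, div_le_iff₀ (Real.exp_pos _)] at this
  have key : ∀ (k : ℕ) (A : Set X),
      (∀ u ∈ A, ∀ v ∈ A, ∀ j < M, dist (T^[j] u) (T^[j] v) ≤ ε / 2) →
      ∀ E : Finset X, ↑E ⊆ T^[k] ⁻¹' A → IsDynSep T k (4 * δ) E →
        ∑ x ∈ E, Real.exp (birk T f k x) ≤ C * Real.exp (k * (b + τ)) := by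
    intro k
    induction k using Nat.strong_induction_on with
    | _ k ih =>
    intro A hA E hEA hE
    rcases E.eq_empty_or_nonempty with rfl | ⟨e, he⟩
    · simp only [Finset.sum_empty]; positivity
    obtain ⟨x, hxt, hx⟩ := ht (T^[k] e)
    have hnL : n x ≤ L := Finset.le_sup hxt
    have hNM : N x ≤ M := Finset.le_sup hxt
    rcases lt_or_ge k (n x) with hk | hk
    · exact (sum_le_sepPn hT f (by positivity) (subset_univ _) hE).trans (hC k (hk.trans_le hnL))
    obtain ⟨m, rfl⟩ := Nat.exists_eq_add_of_le' hk
    let B : X → Set X := fun z =>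
      {y | ∀ i < n x, dist (T^[i] y) (T^[i] z) < 2 * δ} ∩ T^[n x] ⁻¹' A
    have hB : ∀ z, ∀ u ∈ B z, ∀ v ∈ B z, ∀ j < M, dist (T^[j] u) (T^[j] v) ≤ ε / 2 := by
      intro z u hu v hv j hj
      rcases lt_or_ge j (n x) with hjn | hjn
      · have h1 := hu.1 j hjn
        have h2 := hv.1 j hjn
        have := dist_triangle_right (T^[j] u) (T^[j] v) (T^[j] z)
        linarith
      · obtain ⟨i, rfl⟩ := Nat.exists_eq_add_of_le' hjn
        rw [Function.iterate_add_apply, Function.iterate_add_apply]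
        exact hA _ hu.2 _ hv.2 i (by omega)
    have hcover : ∀ y ∈ E, ∃ z ∈ S x, T^[m] y ∈ B z := by
      intro y hy
      have hyA : T^[n x] (T^[m] y) ∈ A := by
        rw [← Function.iterate_add_apply, add_comm]; exact hEA hy
      have : T^[m] y ∈ T^[n x] ⁻¹' {y | ∀ i < N x, dist (T^[i] y) (T^[i] x) ≤ ε} := by
        intro i hi
        have h1 := hA _ hyA _ (hEA he) i (hi.trans_le hNM)
        have h2 := hx i hi
        have := dist_triangle (T^[i] (T^[n x] (T^[m] y))) (T^[i] (T^[m + n x] e)) (T^[i] x)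
        linarith
      obtain ⟨z, hz, hyz⟩ := mem_iUnion₂.1 (hN x this)
      exact ⟨z, hz, hyz, hyA⟩
    have hnx := hn1 x
    calc _ ≤ (∑ z ∈ S x, Real.exp (birk T f (n x) z)) *
          (Real.exp (n x * τ) * (C * Real.exp (m * (b + τ)))) :=
          sum_exp_birk_le_of_cover hτ (fun z y hy => hy.1) hcover hE fun z =>
            ih m (by omega) (B z) (hB z)
      _ ≤ Real.exp (n x * b) * (Real.exp (n x * τ) * (C * Real.exp (m * (b + τ)))) := by
          gcongr
          exact hSsum x
      _ = C * Real.exp ((m + n x : ℕ) * (b + τ)) := by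
          have : ((m + n x : ℕ) : ℝ) * (b + τ) = n x * b + (n x * τ + m * (b + τ)) := by
            push_cast; ring
          rw [this, Real.exp_add, Real.exp_add]
          ring
  obtain ⟨s, hs⟩ := exists_finset_dynBall_cover hT (fun _ => M) (half_pos (half_pos hε))
  refine ⟨max 1 (s.card * C), le_max_left _ _, fun k => sepPn_le fun E _ hE => ?_⟩
  let A : X → Set X := fun c => {y | ∀ i < M, dist (T^[i] y) (T^[i] c) < ε / 2 / 2}
  calc _ ≤ ∑ c ∈ s, ∑ y ∈ E with T^[k] y ∈ A c, Real.exp (birk T f k y) :=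
        sum_le_sum_sum_filter (p := fun c y => T^[k] y ∈ A c)
          (fun y => (Real.exp_pos (birk T f k y)).le) fun y _ => hs (T^[k] y)
    _ ≤ ∑ _c ∈ s, C * Real.exp (k * (b + τ)) := by
        refine Finset.sum_le_sum fun c _ => key k (A c) ?_ _
          (fun y hy => (Finset.mem_filter.1 hy).2) ?_
        · intro u hu v hv j hj
          have h1 := hu j hj
          have h2 := hv j hj
          have := dist_triangle_right (T^[j] u) (T^[j] v) (T^[j] c)
          linarith
        · exact fun u hu v hv => hE u (Finset.mem_filter.1 hu).1 v (Finset.mem_filter.1 hv).1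
    _ = s.card * C * Real.exp (k * (b + τ)) := by simp [mul_assoc]
    _ ≤ _ := by gcongr; exact le_max_right _ _

theorem limsup_log_div_le {P : ℕ → ℝ} {D c : ℝ} (hP : ∀ n, 0 < P n) (hD : 0 < D)
    (h : ∀ n : ℕ, P n ≤ D * Real.exp (n * c)) :
    atTop.limsup (fun n : ℕ => ((Real.log (P n) / n : ℝ) : EReal)) ≤ c := by
  have hlim : Tendsto (fun n : ℕ => ((Real.log D / n + c : ℝ) : EReal)) atTop (𝓝 (c : EReal)) := by
    refine (continuous_coe_real_ereal.tendsto c).comp ?_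
    simpa using (tendsto_const_div_atTop_nhds_zero_nat (Real.log D)).add_const c
  rw [← hlim.limsup_eq]
  refine limsup_le_limsup ?_
  filter_upwards [eventually_gt_atTop 0] with n hn
  have hn' : (0 : ℝ) < n := by exact_mod_cast hn
  rw [EReal.coe_le_coe_iff, div_le_iff₀ hn', add_mul, div_mul_cancel₀ _ hn'.ne']
  have := Real.log_le_log (hP n) (h n)
  rw [Real.log_mul hD.ne' (Real.exp_pos _).ne', Real.log_exp] at this
  linarith

theorem limsup_log_sepPn_mono [MetricSpace X] [CompactSpace X] {T : X → X} (hT : Continuous T)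
    (f : C(X, ℝ)) {δ δ' : ℝ} (hδ : 0 < δ) (hδδ' : δ ≤ δ') {K : ℕ → Set X}
    (hK : ∀ n, (K n).Nonempty) :
    atTop.limsup (fun n : ℕ => ((Real.log (sepPn T f n δ' (K n)) / n : ℝ) : EReal)) ≤
      atTop.limsup (fun n : ℕ => ((Real.log (sepPn T f n δ univ) / n : ℝ) : EReal)) := by
  refine limsup_le_limsup (Eventually.of_forall fun n => ?_)
  rw [EReal.coe_le_coe_iff]
  gcongr
  · exact sepPn_pos hT f n (hδ.trans_le hδδ') (hK n)
  · exact sepPn_mono hT f n hδ hδδ' (subset_univ _)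

/-- For a compact metric space `X`, a surjective continuous
`T : X → X` and `f ∈ C(X,ℝ)`: for every `ε > 0`,
`sup_{x∈X} P_s(T,f,x,ε) = P(T,f)`. -/
theorem stmt7 [MetricSpace X] [CompactSpace X] [Nonempty X]
    (T : X → X) (hT : Continuous T) (hTs : Function.Surjective T)
    (f : C(X, ℝ)) (ε : ℝ) (hε : 0 < ε) :
    (⨆ x : X, Ps T ⇑f x ε) = pres T ⇑f Set.univ := by
  apply le_antisymm
  · refine iSup_le fun x => iSup₂_mono fun δ hδ => limsup_log_sepPn_mono hT f hδ le_rfl fun n => ?_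
    have hx : (epsStable T ε x).Nonempty := ⟨x, fun k => by simpa using hε.le⟩
    exact hx.preimage (hTs.iterate n)
  refine EReal.le_of_forall_lt_iff_le.1 fun c hc => ?_
  obtain ⟨b, hb, hbc⟩ := EReal.lt_iff_exists_real_btwn.1 hc
  have hτ : 0 < c - b := sub_pos.2 (EReal.coe_lt_coe_iff.1 hbc)
  obtain ⟨r, hr, hrf⟩ := Metric.uniformContinuous_iff.1
    (CompactSpace.uniformContinuous_of_continuous f.continuous) _ hτ
  refine iSup₂_le fun δ₀ hδ₀ => ?_
  obtain ⟨δ, hδ, hδmin⟩ : ∃ δ, 0 < δ ∧ 8 * δ ≤ min (min ε r) δ₀ :=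
    ⟨min (min ε r) δ₀ / 8, by positivity, by linarith⟩
  obtain ⟨hδ', hδδ₀⟩ := le_min_iff.1 hδmin
  obtain ⟨hδε, hδr⟩ := le_min_iff.1 hδ'
  have hosc : ∀ u v : X, dist u v < 2 * δ → f u ≤ f v + (c - b) := fun u v huv => by
    have := hrf (huv.trans (by linarith))
    rw [Real.dist_eq] at this
    linarith [le_abs_self (f u - f v)]
  obtain ⟨D, hD, hDn⟩ := exists_sepPn_le_of_forall_epsStable (b := b) hT f hε hδ hδε hosc
    fun x => by
      have hlt : atTop.limsup (fun n : ℕ =>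
          ((Real.log (sepPn T f n δ ((T^[n]) ⁻¹' epsStable T ε x)) / n : ℝ) : EReal)) < b :=
        lt_of_le_of_lt (le_trans (le_iSup₂_of_le δ hδ le_rfl) (le_iSup (fun x => Ps T f x ε) x)) hb
      obtain ⟨n, hn, hn1⟩ :=
        ((eventually_lt_of_limsup_lt hlt).and (eventually_ge_atTop 1)).exists
      refine ⟨n, hn1, ?_⟩
      have hn' : (0 : ℝ) < n := by exact_mod_cast hn1
      rw [EReal.coe_lt_coe_iff, div_lt_iff₀ hn'] at hn
      rcases (sepPn_nonneg T f n δ ((T^[n]) ⁻¹' epsStable T ε x)).eq_or_lt with h0 | h0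
      · rw [← h0]; positivity
      · rw [← Real.log_le_iff_le_exp h0, mul_comm]
        exact hn.le
  rw [add_sub_cancel] at hDn
  refine (limsup_log_sepPn_mono hT f (by positivity : 0 < 4 * δ) (by linarith)
    fun _ => univ_nonempty).trans ?_
  exact limsup_log_div_le (fun n => sepPn_pos hT f n (by positivity) univ_nonempty)
    (by linarith) hDn
end
end
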